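/- arXiv:1804.10353 — 8 statements merged into one kernel-verified Lean document; each statement's English description precedes it below -/
import Mathlib

section
/- If I is a (2,∞)-instance, i.e., every firm has at most two acceptable workers, then spe(I,σ)=qopt(I) for every offering order σ on I: the SPE matching is exactly the Q-optimal stable matching, independently of the offering order. -/
namespace SeqMatching

/-- A matching instance `I = (P, Q, E, ≻)`: firms `P`, workers `Q`, a finite set `E`
of acceptable pairs, and strict preferences encoded by rank functions
(lower rank = more preferred), injective on acceptable partners.
For a firm `p`, `q ≻_p q'` means `rankP p q < rankP p q'`; symmetrically for workers. -/
structure MI (P Q : Type) where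
  E : Finset (P × Q)
  rankP : P → Q → ℕ
  rankQ : Q → P → ℕ
  injP : ∀ p q q', (p, q) ∈ E → (p, q') ∈ E → rankP p q = rankP p q' → q = q'
  injQ : ∀ q p p', (p, q) ∈ E → (p', q) ∈ E → rankQ q p = rankQ q p' → p = p'

namespace MI

variable {P Q : Type}

/-- `μ` is a matching in `I`: a subset of `E` in which every firm and every worker
occurs in at most one pair. -/
def IsMatching (I : MI P Q) (μ : Finset (P × Q)) : Prop :=
  μ ⊆ I.E ∧ ∀ e ∈ μ, ∀ f ∈ μ, (e.1 = f.1 ∨ e.2 = f.2) → e = f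

/-- `μ(q) ⪰_q p`: worker `q` is matched in `μ` to `p` or to a firm she strictly prefers to `p`. -/
def WAtLeast (I : MI P Q) (μ : Finset (P × Q)) (q : Q) (p : P) : Prop :=
  ∃ p', (p', q) ∈ μ ∧ (p' = p ∨ I.rankQ q p' < I.rankQ q p)

/-- `p ≻_q μ(q)`: worker `q` is unmatched in `μ` or matched to a firm strictly less preferred than `p`. -/
def WBelow (I : MI P Q) (μ : Finset (P × Q)) (q : Q) (p : P) : Prop :=
  ∀ p', (p', q) ∈ μ → I.rankQ q p < I.rankQ q p'

/-- `q ≻_p μ(p)`: firm `p` is unmatched in `μ` or matched to a worker strictly less preferred than `q`. -/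
def FBelow (I : MI P Q) (μ : Finset (P × Q)) (p : P) (q : Q) : Prop :=
  ∀ q', (p, q') ∈ μ → I.rankP p q < I.rankP p q'

/-- the acceptable pair `e = (p, q)` blocks `μ`. -/
def Blocks (I : MI P Q) (μ : Finset (P × Q)) (e : P × Q) : Prop :=
  e ∈ I.E ∧ I.FBelow μ e.1 e.2 ∧ I.WBelow μ e.2 e.1

/-- `μ` is a stable matching in `I`. -/
def IsStable (I : MI P Q) (μ : Finset (P × Q)) : Prop :=
  I.IsMatching μ ∧ ∀ e, ¬ I.Blocks μ e

/-- `μ(q) ⪰_q μ'(q)`: worker `q` weakly prefers `μ` to `μ'`. -/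
def WGe (I : MI P Q) (μ μ' : Finset (P × Q)) (q : Q) : Prop :=
  ∀ p', (p', q) ∈ μ' → I.WAtLeast μ q p'

/-- `μ` is the Q-optimal (worker-optimal) stable matching of `I`. -/
def IsQOpt (I : MI P Q) (μ : Finset (P × Q)) : Prop :=
  I.IsStable μ ∧ ∀ μ', I.IsStable μ' → ∀ q, I.WGe μ μ' q

open scoped Classical in
/-- the Q-optimal stable matching `qopt(I)` (it exists and is unique by Gale–Shapley). -/
noncomputable def qopt (I : MI P Q) : Finset (P × Q) :=
  if h : ∃ μ, I.IsQOpt μ then h.choose else ∅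

/-- `q` is the most preferred worker on `p`'s list. -/
def TopForFirm (I : MI P Q) (p : P) (q : Q) : Prop :=
  (p, q) ∈ I.E ∧ ∀ q', (p, q') ∈ I.E → I.rankP p q ≤ I.rankP p q'

/-- `p` is the most preferred firm on `q`'s list. -/
def TopForWorker (I : MI P Q) (q : Q) (p : P) : Prop :=
  (p, q) ∈ I.E ∧ ∀ p', (p', q) ∈ I.E → I.rankQ q p ≤ I.rankQ q p'

variable [DecidableEq P] [DecidableEq Q]

/-- a (2,∞)-instance: every firm has at most two acceptable workers. -/
def FirmsDegTwo (I : MI P Q) : Prop :=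
  ∀ p : P, (I.E.filter (fun f => f.1 = p)).card ≤ 2

/-- an (∞,2)-instance: every worker has at most two acceptable firms. -/
def WorkersDegTwo (I : MI P Q) : Prop :=
  ∀ q : Q, (I.E.filter (fun f => f.2 = q)).card ≤ 2

/-- the deletion `I ∖ e`. -/
def del (I : MI P Q) (e : P × Q) : MI P Q where
  E := I.E.erase e
  rankP := I.rankP
  rankQ := I.rankQ
  injP := fun p q q' h h' hr =>
    I.injP p q q' (Finset.mem_of_mem_erase h) (Finset.mem_of_mem_erase h') hr
  injQ := fun q p p' h h' hr =>
    I.injQ q p p' (Finset.mem_of_mem_erase h) (Finset.mem_of_mem_erase h') hr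

/-- the contraction `I / e`: all pairs containing the firm or the worker of `e` are removed. -/
def contr (I : MI P Q) (e : P × Q) : MI P Q where
  E := I.E.filter (fun f => f.1 ≠ e.1 ∧ f.2 ≠ e.2)
  rankP := I.rankP
  rankQ := I.rankQ
  injP := fun p q q' h h' hr =>
    I.injP p q q' (Finset.filter_subset _ _ h) (Finset.filter_subset _ _ h') hr
  injQ := fun q p p' h h' hr =>
    I.injQ q p p' (Finset.filter_subset _ _ h) (Finset.filter_subset _ _ h') hr

/-- `σ` is an offering order on `I`: an enumeration of `E` without repetition, consistent
with the firms' preferences (if `e ≻_p f` for two offers of the same firm, `e` comes first). -/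
def IsOfferOrder (I : MI P Q) (σ : List (P × Q)) : Prop :=
  σ.Nodup ∧ (∀ e, e ∈ σ ↔ e ∈ I.E) ∧
    ∀ e f, e ∈ σ → f ∈ σ → e.1 = f.1 → I.rankP e.1 e.2 < I.rankP f.1 f.2 →
      σ.idxOf e < σ.idxOf f

/-- restriction `σ / e` of the order `σ` to the pairs of `I / e`. -/
def contrO (σ : List (P × Q)) (e : P × Q) : List (P × Q) :=
  σ.filter (fun f => decide (f.1 ≠ e.1 ∧ f.2 ≠ e.2))

theorem qopt_subset (I : MI P Q) : I.qopt ⊆ I.E := by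
  unfold qopt
  split
  · next h => exact h.choose_spec.1.1.1
  · exact Finset.empty_subset _

/-- the sequentially fixing deferred acceptance algorithm: repeatedly fix the pair of
`qopt` of the current instance that comes first in the offering order. -/
noncomputable def sfda (I : MI P Q) (σ : List (P × Q)) : Finset (P × Q) :=
  match h : σ.find? (fun f => decide (f ∈ I.qopt)) with
  | none => ∅
  | some e => insert e ((I.contr e).sfda (contrO σ e))
termination_by σ.length
decreasing_by
  have he : e ∈ σ := List.mem_of_find?_eq_some h
  have hfail : ¬ (fun f => decide (f.1 ≠ e.1 ∧ f.2 ≠ e.2)) e = true := by simp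
  exact List.length_filter_lt_length_iff_exists.mpr ⟨e, he, hfail⟩

open scoped Classical in
/-- the SPE matching `spe(I, σ)` of the sequential matching game `(I, σ)`. -/
noncomputable def spe (I : MI P Q) (σ : List (P × Q)) : Finset (P × Q) :=
  match σ with
  | [] => ∅
  | e :: rest =>
    if I.WBelow ((I.del e).spe rest) e.2 e.1
    then insert e ((I.contr e).spe (contrO rest e))
    else (I.del e).spe rest
termination_by σ.length
decreasing_by
  all_goals simp only [contrO, List.length_cons]
  all_goals first
    | omega
    | exact Nat.lt_succ_of_le (List.length_filter_le _ _)


/-- counting lemma: the rural-hospitals argument -/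
theorem rural_count (A B : Finset (P × Q))
    (hA : ∀ e ∈ A, ∀ f ∈ A, (e.1 = f.1 ∨ e.2 = f.2) → e = f)
    (hB : ∀ e ∈ B, ∀ f ∈ B, (e.1 = f.1 ∨ e.2 = f.2) → e = f)
    (hw : ∀ p q, (p, q) ∈ B → ∃ p', (p', q) ∈ A)
    (hf : ∀ p q, (p, q) ∈ A → ∃ q', (p, q') ∈ B) :
    ∀ p q, (p, q) ∈ B → ∃ q', (p, q') ∈ A := by
  have h1 : (A.image Prod.fst).card = A.card :=
    Finset.card_image_of_injOn (fun e he f hf h => hA e he f hf (Or.inl h))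
  have h2 : (B.image Prod.fst).card = B.card :=
    Finset.card_image_of_injOn (fun e he f hf h => hB e he f hf (Or.inl h))
  have h3 : (A.image Prod.snd).card = A.card :=
    Finset.card_image_of_injOn (fun e he f hf h => hA e he f hf (Or.inr h))
  have h4 : (B.image Prod.snd).card = B.card :=
    Finset.card_image_of_injOn (fun e he f hf h => hB e he f hf (Or.inr h))
  have h5 : B.image Prod.snd ⊆ A.image Prod.snd := by
    intro q hq
    obtain ⟨⟨p, q'⟩, hpq, rfl⟩ := Finset.mem_image.1 hq
    obtain ⟨p', hp'⟩ := hw _ _ hpq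
    exact Finset.mem_image.2 ⟨_, hp', rfl⟩
  have h6 : A.image Prod.fst ⊆ B.image Prod.fst := by
    intro p hp
    obtain ⟨⟨p', q⟩, hpq, rfl⟩ := Finset.mem_image.1 hp
    obtain ⟨q', hq'⟩ := hf _ _ hpq
    exact Finset.mem_image.2 ⟨_, hq', rfl⟩
  have h7 := Finset.card_le_card h5
  have h8 : A.image Prod.fst = B.image Prod.fst :=
    Finset.eq_of_subset_of_card_le h6 (by omega)
  intro p q hpq
  have : p ∈ A.image Prod.fst := by
    rw [h8]; exact Finset.mem_image.2 ⟨_, hpq, rfl⟩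
  obtain ⟨⟨p', q'⟩, h, rfl⟩ := Finset.mem_image.1 this
  exact ⟨q', h⟩

theorem IsMatching.firm {I : MI P Q} {μ : Finset (P × Q)} (h : I.IsMatching μ) {p : P} {q q' : Q}
    (h1 : (p, q) ∈ μ) (h2 : (p, q') ∈ μ) : q = q' :=
  congrArg Prod.snd (h.2 _ h1 _ h2 (Or.inl rfl))

theorem IsMatching.worker {I : MI P Q} {μ : Finset (P × Q)} (h : I.IsMatching μ) {p p' : P} {q : Q}
    (h1 : (p, q) ∈ μ) (h2 : (p', q) ∈ μ) : p = p' :=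
  congrArg Prod.fst (h.2 _ h1 _ h2 (Or.inr rfl))

theorem qopt_unique {I : MI P Q} {μ ν : Finset (P × Q)} (hμ : I.IsQOpt μ) (hν : I.IsQOpt ν) :
    μ ⊆ ν := by
  rintro ⟨p, q⟩ h
  obtain ⟨p', hp', h1⟩ := hν.2 μ hμ.1 q p h
  obtain ⟨p'', hp'', h2⟩ := hμ.2 ν hν.1 q p' hp'
  have : p'' = p := hμ.1.1.worker hp'' h
  subst this
  rcases h1 with rfl | h1
  · exact hp'
  · rcases h2 with rfl | h2
    · exact hp'
    · omega

/-- Gale–Shapley: a stable matching exists. -/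
theorem exists_stable (n : ℕ) : ∀ I : MI P Q, I.E.card = n → ∃ μ, I.IsStable μ := by
  classical
  induction n using Nat.strong_induction_on with
  | _ n ih =>
  intro I hn
  by_cases hc : ∃ p₁ p₂ q, I.TopForFirm p₁ q ∧ I.TopForFirm p₂ q ∧ I.rankQ q p₁ < I.rankQ q p₂
  · obtain ⟨p₁, p₂, q, h1, h2, hlt⟩ := hc
    have hcard : (I.del (p₂, q)).E.card < n := by
      rw [← hn]; exact Finset.card_erase_lt_of_mem h2.1
    obtain ⟨μ, hμ⟩ := ih _ hcard _ rfl
    have hne : p₁ ≠ p₂ := by rintro rfl; omega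
    refine ⟨μ, ⟨hμ.1.1.trans (Finset.erase_subset _ _), hμ.1.2⟩, ?_⟩
    rintro e ⟨he, hF, hW⟩
    by_cases hee : e = (p₂, q)
    · subst hee
      refine hμ.2 (p₁, q) ⟨Finset.mem_erase.2 ⟨by simp [hne], h1.1⟩, ?_, ?_⟩
      · intro q' hq'
        have hE : (p₁, q') ∈ I.E := Finset.mem_of_mem_erase (hμ.1.1 hq')
        have := h1.2 q' hE
        rcases this.lt_or_eq with h | h
        · exact h
        · have := I.injP _ _ _ h1.1 hE h
          subst this
          have := hW _ hq'
          simp only at this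
          omega
      · intro p' hp'
        have := hW _ hp'
        simp only at this
        exact lt_trans hlt this
    · exact hμ.2 e ⟨Finset.mem_erase.2 ⟨hee, he⟩, hF, hW⟩
  · push Not at hc
    refine ⟨I.E.filter (fun f => I.TopForFirm f.1 f.2), ⟨Finset.filter_subset _ _, ?_⟩, ?_⟩
    · rintro ⟨p, q⟩ he ⟨p', q'⟩ hf h
      simp only [Finset.mem_filter] at he hf h
      rcases h with rfl | rfl
      · have := I.injP _ _ _ he.1 hf.1 (le_antisymm (he.2.2 _ hf.1) (hf.2.2 _ he.1))
        rw [this]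
      · have := I.injQ _ _ _ he.1 hf.1
          (le_antisymm (hc _ _ _ hf.2 he.2) (hc _ _ _ he.2 hf.2))
        rw [this]
    · rintro ⟨p, q⟩ ⟨he, hF, -⟩
      obtain ⟨⟨p', q'⟩, hm, hmin⟩ := Finset.exists_min_image (I.E.filter (fun f => f.1 = p))
        (fun f => I.rankP p f.2) ⟨(p, q), by simpa using he⟩
      simp only [Finset.mem_filter] at hm
      obtain ⟨hm, rfl⟩ := hm
      have h1 := hF q' (by
        simp only [Finset.mem_filter]
        exact ⟨hm, hm, fun a ha => hmin (p', a) (by simpa using ha)⟩)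
      have h2 := hmin (p', q) (by simpa using he)
      simp only at h1 h2
      omega

/-- the join of two stable matchings -/
theorem exists_join {I : MI P Q} {μ ν : Finset (P × Q)} (hμ : I.IsStable μ) (hν : I.IsStable ν) :
    ∃ J, I.IsStable J ∧ (∀ q p, (p, q) ∈ μ → I.WAtLeast J q p) ∧
      (∀ q p, (p, q) ∈ ν → I.WAtLeast J q p) ∧ J ⊆ μ ∪ ν := by
  classical
  let better : Finset (P × Q) → P × Q → Prop := fun B f =>
    ∀ p', (p', f.2) ∈ B → I.rankQ f.2 f.1 ≤ I.rankQ f.2 p'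
  let J := μ.filter (better ν) ∪ ν.filter (better μ)
  have memJ : ∀ p q, (p, q) ∈ J ↔
      ((p, q) ∈ μ ∧ ∀ p', (p', q) ∈ ν → I.rankQ q p ≤ I.rankQ q p') ∨
      ((p, q) ∈ ν ∧ ∀ p', (p', q) ∈ μ → I.rankQ q p ≤ I.rankQ q p') := by
    intro p q; simp [J, better]
  have hEμ : ∀ {p q}, (p, q) ∈ μ → (p, q) ∈ I.E := fun h => hμ.1.1 h
  have hEν : ∀ {p q}, (p, q) ∈ ν → (p, q) ∈ I.E := fun h => hν.1.1 h
  have geμ : ∀ q p, (p, q) ∈ μ → I.WAtLeast J q p := by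
    intro q p h
    by_cases hb : ∀ p', (p', q) ∈ ν → I.rankQ q p ≤ I.rankQ q p'
    · exact ⟨p, (memJ _ _).2 (Or.inl ⟨h, hb⟩), Or.inl rfl⟩
    · push Not at hb
      obtain ⟨p', hp', hlt⟩ := hb
      refine ⟨p', (memJ _ _).2 (Or.inr ⟨hp', fun p'' h'' => ?_⟩), Or.inr hlt⟩
      rw [hμ.1.worker h'' h]; exact hlt.le
  have geν : ∀ q p, (p, q) ∈ ν → I.WAtLeast J q p := by
    intro q p h
    by_cases hb : ∀ p', (p', q) ∈ μ → I.rankQ q p ≤ I.rankQ q p'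
    · exact ⟨p, (memJ _ _).2 (Or.inr ⟨h, hb⟩), Or.inl rfl⟩
    · push Not at hb
      obtain ⟨p', hp', hlt⟩ := hb
      refine ⟨p', (memJ _ _).2 (Or.inl ⟨hp', fun p'' h'' => ?_⟩), Or.inr hlt⟩
      rw [hν.1.worker h'' h]; exact hlt.le
  have conflict : ∀ p q q', (p, q) ∈ μ → (∀ p', (p', q) ∈ ν → I.rankQ q p ≤ I.rankQ q p') →
      (p, q') ∈ ν → (∀ p', (p', q') ∈ μ → I.rankQ q' p ≤ I.rankQ q' p') → q = q' := by
    intro p q q' h1 h2 h3 h4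
    by_contra hne
    have hr : I.rankP p q ≠ I.rankP p q' := fun h => hne (I.injP _ _ _ (hEμ h1) (hEν h3) h)
    rcases lt_or_gt_of_ne hr with h | h
    · refine hν.2 (p, q) ⟨hEμ h1, fun a ha => ?_, fun a ha => ?_⟩
      · rw [hν.1.firm ha h3]; exact h
      · rcases (h2 a ha).lt_or_eq with h' | h'
        · exact h'
        · have := I.injQ _ _ _ (hEμ h1) (hEν ha) h'
          subst this
          exact absurd (hν.1.firm ha h3) hne
    · refine hμ.2 (p, q') ⟨hEν h3, fun a ha => ?_, fun a ha => ?_⟩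
      · rw [hμ.1.firm ha h1]; exact h
      · rcases (h4 a ha).lt_or_eq with h' | h'
        · exact h'
        · have := I.injQ _ _ _ (hEν h3) (hEμ ha) h'
          subst this
          exact absurd (hμ.1.firm h1 ha) hne
  have hsub : J ⊆ μ ∪ ν :=
    Finset.union_subset_union (Finset.filter_subset _ _) (Finset.filter_subset _ _)
  have hsubE : J ⊆ I.E := hsub.trans (Finset.union_subset hμ.1.1 hν.1.1)
  have hJ : I.IsMatching J := by
    refine ⟨hsubE, ?_⟩
    rintro ⟨p, q⟩ he ⟨p', q'⟩ hf h
    rw [memJ] at he hf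
    simp only at h
    rcases h with rfl | rfl
    · rcases he with he | he <;> rcases hf with hf | hf
      · rw [hμ.1.firm he.1 hf.1]
      · rw [conflict _ _ _ he.1 he.2 hf.1 hf.2]
      · rw [conflict _ _ _ hf.1 hf.2 he.1 he.2]
      · rw [hν.1.firm he.1 hf.1]
    · rcases he with he | he <;> rcases hf with hf | hf
      · rw [hμ.1.worker he.1 hf.1]
      · rw [I.injQ _ _ _ (hEμ he.1) (hEν hf.1) (le_antisymm (he.2 _ hf.1) (hf.2 _ he.1))]
      · rw [I.injQ _ _ _ (hEν he.1) (hEμ hf.1) (le_antisymm (he.2 _ hf.1) (hf.2 _ he.1))]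
      · rw [hν.1.worker he.1 hf.1]
  refine ⟨J, ⟨hJ, ?_⟩, geμ, geν, hsub⟩
  have cnt : ∀ p q, (p, q) ∈ μ → ∃ q', (p, q') ∈ J := by
    refine rural_count J μ hJ.2 hμ.1.2 ?_ ?_
    · intro p q h
      obtain ⟨p', h', -⟩ := geμ q p h
      exact ⟨p', h'⟩
    · intro p q h
      rw [memJ] at h
      rcases h with h | h
      · exact ⟨q, h.1⟩
      · by_contra hno
        push Not at hno
        refine hμ.2 (p, q) ⟨hEν h.1, fun a ha => absurd ha (hno a), fun a ha => ?_⟩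
        rcases (h.2 a ha).lt_or_eq with h' | h'
        · exact h'
        · have := I.injQ _ _ _ (hEν h.1) (hEμ ha) h'
          subst this
          exact absurd ha (hno _)
  rintro ⟨p, q⟩ ⟨he, hF, hW⟩
  simp only at hF hW
  have hWμ : I.WBelow μ q p := by
    intro a ha
    obtain ⟨b, hb, hab⟩ := geμ q a ha
    have := hW b hb
    rcases hab with rfl | hab <;> omega
  have hWν : I.WBelow ν q p := by
    intro a ha
    obtain ⟨b, hb, hab⟩ := geν q a ha
    have := hW b hb
    rcases hab with rfl | hab <;> omega
  have h1 : ¬ I.FBelow μ p q := fun h => hμ.2 (p, q) ⟨he, h, hWμ⟩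
  have h2 : ¬ I.FBelow ν p q := fun h => hν.2 (p, q) ⟨he, h, hWν⟩
  unfold FBelow at h1 h2
  push Not at h1 h2
  obtain ⟨a, ha, hra⟩ := h1
  obtain ⟨b, hb, hrb⟩ := h2
  obtain ⟨c, hc⟩ := cnt p a ha
  have hlt := hF c hc
  rcases Finset.mem_union.1 (hsub hc) with h | h
  · rw [hμ.1.firm h ha] at hlt; omega
  · rw [hν.1.firm h hb] at hlt; omega

/-- stability passes from `I` to `I ∖ e` for matchings avoiding `e` -/
theorem IsStable.del {I : MI P Q} {μ : Finset (P × Q)} {e : P × Q} (h : I.IsStable μ)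
    (he : e ∉ μ) : (I.del e).IsStable μ :=
  ⟨⟨fun f hf => Finset.mem_erase.2 ⟨fun h' => he (h' ▸ hf), h.1.1 hf⟩, h.1.2⟩,
    fun f hf => h.2 f ⟨Finset.mem_of_mem_erase hf.1, hf.2.1, hf.2.2⟩⟩

/-- stability of `μ - e` in `I / e` -/
theorem IsStable.contr {I : MI P Q} {μ : Finset (P × Q)} {e : P × Q} (h : I.IsStable μ)
    (he : e ∈ μ) : (I.contr e).IsStable (μ.erase e) := by
  refine ⟨⟨fun f hf => ?_, fun f hf g hg => h.1.2 f (Finset.mem_of_mem_erase hf) g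
    (Finset.mem_of_mem_erase hg)⟩, ?_⟩
  · obtain ⟨hne, hf⟩ := Finset.mem_erase.1 hf
    exact Finset.mem_filter.2 ⟨h.1.1 hf, fun h' => hne (h.1.2 _ hf _ he (Or.inl h')),
      fun h' => hne (h.1.2 _ hf _ he (Or.inr h'))⟩
  · rintro ⟨p, q⟩ ⟨hE, hF, hW⟩
    obtain ⟨hE, h1, h2⟩ := Finset.mem_filter.1 hE
    refine h.2 (p, q) ⟨hE, fun a ha => hF a (Finset.mem_erase.2 ⟨?_, ha⟩),
      fun a ha => hW a (Finset.mem_erase.2 ⟨?_, ha⟩)⟩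
    · rintro rfl; exact h1 rfl
    · rintro rfl; exact h2 rfl

theorem qopt_of_del {I : MI P Q} {ν : Finset (P × Q)} {p : P} {q : Q} (he : (p, q) ∈ I.E)
    (hν : (I.del (p, q)).IsQOpt ν) (hb : ¬ I.WBelow ν q p) : I.IsQOpt ν := by
  unfold WBelow at hb
  push Not at hb
  obtain ⟨p', hp', hle⟩ := hb
  have hE' := Finset.mem_erase.1 (hν.1.1.1 hp')
  have hne : p' ≠ p := by rintro rfl; exact hE'.1 rfl
  have hlt : I.rankQ q p' < I.rankQ q p :=
    lt_of_le_of_ne hle (fun h => hne (I.injQ _ _ _ hE'.2 he h))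
  have hst : I.IsStable ν := by
    refine ⟨⟨hν.1.1.1.trans (Finset.erase_subset _ _), hν.1.1.2⟩, ?_⟩
    rintro e ⟨h1, h2, h3⟩
    by_cases hee : e = (p, q)
    · subst hee
      have := h3 p' hp'
      simp only at this
      omega
    · exact hν.1.2 e ⟨Finset.mem_erase.2 ⟨hee, h1⟩, h2, h3⟩
  refine ⟨hst, ?_⟩
  intro μ hμ r s hs
  obtain ⟨J, hJ, hJν, hJμ, -⟩ := exists_join hst hμ
  have heJ : (p, q) ∉ J := by
    intro h
    obtain ⟨a, ha, hra⟩ := hJν q p' hp'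
    have := hJ.1.worker ha h
    subst this
    rcases hra with rfl | hra
    · exact hne rfl
    · omega
  obtain ⟨a, ha, hra⟩ := hJμ r s hs
  obtain ⟨b, hb, hrb⟩ := hν.2 J (hJ.del heJ) r a ha
  refine ⟨b, hb, ?_⟩
  change b = a ∨ I.rankQ r b < I.rankQ r a at hrb
  rcases hrb with rfl | hrb
  · exact hra
  · right
    rcases hra with rfl | hra
    · exact hrb
    · exact hrb.trans hra

theorem qopt_of_contr {I : MI P Q} {ν lam : Finset (P × Q)} {p : P} {q : Q}
    (htop : I.TopForFirm p q)
    (h2 : ∀ p a b c, (p, a) ∈ I.E → (p, b) ∈ I.E → (p, c) ∈ I.E → a = b ∨ a = c ∨ b = c)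
    (hν : (I.del (p, q)).IsQOpt ν) (hb : I.WBelow ν q p)
    (hl : (I.contr (p, q)).IsQOpt lam) : I.IsQOpt (insert (p, q) lam) := by
  have hall : ∀ μ, I.IsStable μ → (p, q) ∈ μ := by
    intro μ hμ
    by_contra hno
    refine hμ.2 (p, q) ⟨htop.1, fun a ha => ?_, fun a ha => ?_⟩
    · rcases (htop.2 a (hμ.1.1 ha)).lt_or_eq with h | h
      · exact h
      · have := I.injP _ _ _ htop.1 (hμ.1.1 ha) h
        subst this
        exact absurd ha hno
    · obtain ⟨b, hb', hrb⟩ := hν.2 μ (hμ.del hno) q a ha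
      have h3 := hb b hb'
      change b = a ∨ I.rankQ q b < I.rankQ q a at hrb
      simp only
      rcases hrb with rfl | hrb
      · exact h3
      · omega
  have hlE : ∀ {a b}, (a, b) ∈ lam → (a, b) ∈ I.E ∧ a ≠ p ∧ b ≠ q := fun h =>
    Finset.mem_filter.1 (hl.1.1.1 h)
  have hst : I.IsStable (insert (p, q) lam) := by
    refine ⟨⟨?_, ?_⟩, ?_⟩
    · exact Finset.insert_subset htop.1 (hl.1.1.1.trans (Finset.filter_subset _ _))
    · rintro ⟨a, b⟩ he ⟨c, d⟩ hf h
      rcases Finset.mem_insert.1 he with he₁ | he₁ <;>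
        rcases Finset.mem_insert.1 hf with hf₁ | hf₁
      · rw [he₁, hf₁]
      · obtain ⟨rfl, rfl⟩ := Prod.mk.inj he₁
        obtain ⟨-, h3, h4⟩ := hlE hf₁
        rcases h with h | h
        · exact absurd h.symm h3
        · exact absurd h.symm h4
      · obtain ⟨rfl, rfl⟩ := Prod.mk.inj hf₁
        obtain ⟨-, h3, h4⟩ := hlE he₁
        rcases h with h | h
        · exact absurd h h3
        · exact absurd h h4
      · exact hl.1.1.2 _ he₁ _ hf₁ h
    · rintro ⟨a, b⟩ ⟨hE, hF, hW⟩
      simp only at hF hW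
      by_cases hap : a = p
      · subst hap
        have := hF q (Finset.mem_insert_self _ _)
        have := htop.2 b hE
        omega
      by_cases hbq : b = q
      · subst hbq
        have hlt := hW p (Finset.mem_insert_self _ _)
        obtain ⟨μ, hμ⟩ := exists_stable _ I rfl
        have hpμ := hall μ hμ
        have hnF : ¬ I.FBelow μ a b := fun h => hμ.2 (a, b) ⟨hE, h, fun c hc => by
          rw [hμ.1.worker hc hpμ]; exact hlt⟩
        unfold FBelow at hnF
        push Not at hnF
        obtain ⟨c, hc, hrc⟩ := hnF
        have hμ' := hμ.contr hpμ
        have hcnt : ∀ s r, (s, r) ∈ μ.erase (p, b) → ∃ r₁, (s, r₁) ∈ lam := by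
          refine rural_count lam _ hl.1.1.2 hμ'.1.2 ?_ ?_
          · intro s r hsr
            obtain ⟨s', hs', -⟩ := hl.2 _ hμ' r s hsr
            exact ⟨s', hs'⟩
          · intro s r hsr
            by_contra hno
            push Not at hno
            refine hμ'.2 (s, r) ⟨hl.1.1.1 hsr, fun x hx => absurd hx (hno x), fun x hx => ?_⟩
            obtain ⟨y, hy, hry⟩ := hl.2 _ hμ' r x hx
            have := hl.1.1.worker hy hsr
            subst this
            rcases hry with rfl | hry
            · exact absurd hx (hno _)
            · exact hry
        obtain ⟨d, hd⟩ := hcnt a c (Finset.mem_erase.2 ⟨by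
          intro h; exact hap (congrArg Prod.fst h), hc⟩)
        have hcb : c ≠ b := by
          rintro rfl; exact hap (hμ.1.worker hc hpμ)
        have hdE := hlE hd
        have hFd := hF d (Finset.mem_insert_of_mem hd)
        rcases h2 a c d b (hμ.1.1 hc) hdE.1 hE with h | h | h
        · subst h; omega
        · exact hcb h
        · exact hdE.2.2 h
      · exact hl.1.2 (a, b) ⟨Finset.mem_filter.2 ⟨hE, hap, hbq⟩,
          fun x hx => hF x (Finset.mem_insert_of_mem hx),
          fun x hx => hW x (Finset.mem_insert_of_mem hx)⟩
  refine ⟨hst, ?_⟩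
  intro μ hμ r s hs
  have hpμ := hall μ hμ
  by_cases h : (s, r) = (p, q)
  · obtain ⟨rfl, rfl⟩ := Prod.mk.inj h
    exact ⟨_, Finset.mem_insert_self _ _, Or.inl rfl⟩
  · obtain ⟨x, hx, hrx⟩ := hl.2 _ (hμ.contr hpμ) r s (Finset.mem_erase.2 ⟨h, hs⟩)
    exact ⟨x, Finset.mem_insert_of_mem hx, hrx⟩

theorem spe_isQOpt (n : ℕ) : ∀ (I : MI P Q) (σ : List (P × Q)), σ.length = n →
    (∀ p a b c, (p, a) ∈ I.E → (p, b) ∈ I.E → (p, c) ∈ I.E → a = b ∨ a = c ∨ b = c) →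
    σ.Nodup → (∀ e, e ∈ σ ↔ e ∈ I.E) →
    σ.Pairwise (fun e f => e.1 = f.1 → I.rankP e.1 e.2 ≤ I.rankP f.1 f.2) →
    I.IsQOpt (I.spe σ) := by
  induction n using Nat.strong_induction_on with
  | _ n ih =>
  intro I σ hn h2 hnd hmem hpw
  match σ with
  | [] =>
    rw [spe]
    have hE : I.E = ∅ := Finset.eq_empty_of_forall_notMem (fun e he => by
      simpa using (hmem e).2 he)
    refine ⟨⟨⟨Finset.empty_subset _, by simp⟩, ?_⟩, ?_⟩
    · rintro e ⟨h, -⟩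
      rw [hE] at h; simp at h
    · intro μ hμ q p h
      have := hμ.1.1 h
      rw [hE] at this; simp at this
  | (p, q) :: rest =>
    obtain ⟨hnot, hnd'⟩ := List.nodup_cons.1 hnd
    obtain ⟨hhd, hpw'⟩ := List.pairwise_cons.1 hpw
    have he : (p, q) ∈ I.E := (hmem _).1 (List.mem_cons_self)
    have htop : I.TopForFirm p q := by
      refine ⟨he, fun q' hq' => ?_⟩
      rcases List.mem_cons.1 ((hmem _).2 hq') with h | h
      · rw [(Prod.mk.inj h).2]
      · exact hhd _ h rfl
    have hlen : rest.length < n := by rw [← hn]; simp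
    have hdel : (I.del (p, q)).IsQOpt ((I.del (p, q)).spe rest) := by
      refine ih _ hlen _ _ rfl ?_ hnd' ?_ hpw'
      · intro p a b c h h' h''
        exact h2 p a b c (Finset.mem_of_mem_erase h) (Finset.mem_of_mem_erase h')
          (Finset.mem_of_mem_erase h'')
      · intro e
        change _ ↔ e ∈ I.E.erase (p, q)
        rw [Finset.mem_erase, ← hmem, List.mem_cons]
        constructor
        · exact fun h => ⟨fun h' => hnot (h' ▸ h), Or.inr h⟩
        · rintro ⟨h, h' | h'⟩
          · exact absurd h' h
          · exact h'
    have hcon : (I.contr (p, q)).IsQOpt ((I.contr (p, q)).spe (contrO rest (p, q))) := by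
      refine ih _ (lt_of_le_of_lt (List.length_filter_le _ _) hlen) _ _ rfl ?_
        (hnd'.filter _) ?_ (hpw'.filter _)
      · intro p a b c h h' h''
        exact h2 p a b c (Finset.filter_subset _ _ h) (Finset.filter_subset _ _ h')
          (Finset.filter_subset _ _ h'')
      · intro e
        change e ∈ List.filter _ _ ↔ e ∈ Finset.filter _ _
        rw [Finset.mem_filter, List.mem_filter, ← hmem, List.mem_cons, decide_eq_true_iff]
        constructor
        · exact fun h => ⟨Or.inr h.1, h.2⟩
        · rintro ⟨h | h, h'⟩
          · exact absurd (congrArg Prod.fst h) h'.1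
          · exact ⟨h, h'⟩
    rw [spe]
    split_ifs with hb
    · exact qopt_of_contr htop h2 hdel hb hcon
    · exact qopt_of_del he hdel hb

/-- if every firm has at most two acceptable workers, then
`spe(I, σ) = qopt(I)` for every offering order `σ`. -/
theorem stmt_11 (P Q : Type) [DecidableEq P] [DecidableEq Q] (I : MI P Q)
    (h2 : I.FirmsDegTwo)
    (σ : List (P × Q)) (hσ : I.IsOfferOrder σ)
    (μ₀ : Finset (P × Q)) (h₀ : I.IsQOpt μ₀) :
    I.spe σ = μ₀ := by
  have h3 : I.IsQOpt (I.spe σ) := by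
    obtain ⟨hnd, hmem, hord⟩ := hσ
    refine spe_isQOpt _ I σ rfl ?_ hnd hmem ?_
    · intro p a b c ha hb hc
      by_contra hno
      push Not at hno
      have hsub : ({(p, a), (p, b), (p, c)} : Finset (P × Q)) ⊆ I.E.filter (fun f => f.1 = p) := by
        intro f hf
        simp only [Finset.mem_insert, Finset.mem_singleton] at hf
        rcases hf with rfl | rfl | rfl <;> simp [ha, hb, hc]
      have h1 := Finset.card_le_card hsub
      have h4 := h2 p
      rw [Finset.card_eq_three.2 ⟨(p, a), (p, b), (p, c), by simp [hno.1], by simp [hno.2.1],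
        by simp [hno.2.2], rfl⟩] at h1
      omega
    · rw [List.pairwise_iff_getElem]
      intro i j hi hj hij heq
      by_contra hlt
      push Not at hlt
      have := hord _ _ (List.getElem_mem hj) (List.getElem_mem hi) heq.symm hlt
      rw [hnd.idxOf_getElem, hnd.idxOf_getElem] at this
      omega
  exact Finset.Subset.antisymm (qopt_unique h3 h₀) (qopt_unique h₀ h3)

end MI

end SeqMatching
end

section
/- (Strengthened blocking lemma.) Let I be a matching instance and μ' a matching with μ'(q) ⪰_q qopt(I)(q) for every worker q and μ' ≠ qopt(I). Let Q' = {q ∈ Q : μ'(q) ≻_q qopt(I)(q)}. Then there exists a pair (p,q) ∈ E that blocks μ' such that p is matched in μ' to some worker of Q', q ∉ Q', and no worker q̃ ∈ Γ(p) satisfies both qopt(I)(p) ≻_p q̃ ≻_p q and p ≻_{q̃} qopt(I)(q̃). -/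
namespace SeqMatching

namespace MI

variable {P Q : Type}

variable [DecidableEq P] [DecidableEq Q]

/-- strengthened blocking lemma: if `μ' ⪰_Q qopt(I)` and `μ' ≠ qopt(I)`,
with `Q' = {q : μ'(q) ≻_q qopt(I)(q)}`, then some `(p, q) ∈ E` blocks `μ'`, where `p` is
matched in `μ'` to a worker of `Q'`, `q ∉ Q'`, and no worker `q̃ ∈ Γ(p)` satisfies both
`qopt(I)(p) ≻_p q̃ ≻_p q` and `p ≻_{q̃} qopt(I)(q̃)`. -/
theorem stmt_12 (P Q : Type) (I : MI P Q) (μ₀ μ' : Finset (P × Q))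
    (h₀ : I.IsQOpt μ₀) (hm : I.IsMatching μ')
    (hge : ∀ q : Q, I.WGe μ' μ₀ q) (hne : μ' ≠ μ₀) :
    ∃ p q, I.Blocks μ' (p, q) ∧
      (∃ q', (p, q') ∈ μ' ∧ I.WBelow μ₀ q' p) ∧
      ¬ (∃ p'', (p'', q) ∈ μ' ∧ I.WBelow μ₀ q p'') ∧
      ∀ qt, (p, qt) ∈ I.E →
        ¬ ((∃ qm, (p, qm) ∈ μ₀ ∧ I.rankP p qm < I.rankP p qt) ∧
           I.rankP p qt < I.rankP p q ∧ I.WBelow μ₀ qt p) := by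
  classical
  obtain ⟨⟨⟨hsub, huniq⟩, hstab⟩, hopt⟩ := h₀
  obtain ⟨hsub', huniq'⟩ := hm
  have fst0 : ∀ {p q q'}, (p, q) ∈ μ₀ → (p, q') ∈ μ₀ → q = q' := fun h h' =>
    congrArg Prod.snd (huniq _ h _ h' (Or.inl rfl))
  have snd0 : ∀ {p p' q}, (p, q) ∈ μ₀ → (p', q) ∈ μ₀ → p = p' := fun h h' =>
    congrArg Prod.fst (huniq _ h _ h' (Or.inr rfl))
  have fst1 : ∀ {p q q'}, (p, q) ∈ μ' → (p, q') ∈ μ' → q = q' := fun h h' =>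
    congrArg Prod.snd (huniq' _ h _ h' (Or.inl rfl))
  have snd1 : ∀ {p p' q}, (p, q) ∈ μ' → (p', q) ∈ μ' → p = p' := fun h h' =>
    congrArg Prod.fst (huniq' _ h _ h' (Or.inr rfl))
  -- workers outside `Q'` keep their partner
  have hkeep : ∀ q, ¬ (∃ p'', (p'', q) ∈ μ' ∧ I.WBelow μ₀ q p'') →
      ∀ p, (p, q) ∈ μ₀ ↔ (p, q) ∈ μ' := by
    intro q hq p
    constructor
    · intro h
      obtain ⟨p', hp', rfl | hlt⟩ := hge q p h
      · exact hp'
      · exact absurd ⟨p', hp', fun p2 h2 => by rw [snd0 h2 h]; exact hlt⟩ hq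
    · intro h
      by_contra hn
      apply hq
      refine ⟨p, h, fun p2 h2 => ?_⟩
      obtain ⟨p', hp', rfl | hlt⟩ := hge q p2 h2
      · exact absurd (snd1 h hp' ▸ h2) hn
      · rw [snd1 h hp']; exact hlt
  have hstab' : ∀ p q, (p, q) ∈ I.E → I.WBelow μ₀ q p →
      ∃ qm, (p, qm) ∈ μ₀ ∧ I.rankP p qm ≤ I.rankP p q := by
    intro p q hE hW
    by_contra hcon
    push Not at hcon
    exact hstab (p, q) ⟨hE, hcon, hW⟩
  let M' := μ'.filter (fun e => I.WBelow μ₀ e.2 e.1)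
  let M0 := μ₀.filter (fun e => ∃ p'', (p'', e.2) ∈ μ' ∧ I.WBelow μ₀ e.2 p'')
  have hP : M'.image Prod.fst ⊆ M0.image Prod.fst := by
    intro p hp
    obtain ⟨⟨p1, q1⟩, he, rfl⟩ := Finset.mem_image.1 hp
    obtain ⟨he1, he2⟩ := Finset.mem_filter.1 he
    obtain ⟨qm, hqm, -⟩ := hstab' p1 q1 (hsub' he1) he2
    refine Finset.mem_image.2 ⟨(p1, qm), Finset.mem_filter.2 ⟨hqm, ?_⟩, rfl⟩
    by_contra hcon
    have h1 := (hkeep qm hcon p1).1 hqm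
    have h2 := fst1 he1 h1
    subst h2
    exact hcon ⟨p1, he1, he2⟩
  have hQ : M0.image Prod.snd ⊆ M'.image Prod.snd := by
    intro q hq
    obtain ⟨⟨p1, q1⟩, he, rfl⟩ := Finset.mem_image.1 hq
    obtain ⟨he1, p2, h2, h3⟩ := Finset.mem_filter.1 he
    exact Finset.mem_image.2 ⟨(p2, q1), Finset.mem_filter.2 ⟨h2, h3⟩, rfl⟩
  have c1 : (M'.image Prod.fst).card = M'.card := Finset.card_image_of_injOn fun a ha b hb h =>
    huniq' a (Finset.mem_filter.1 ha).1 b (Finset.mem_filter.1 hb).1 (Or.inl h)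
  have c2 : (M'.image Prod.snd).card = M'.card := Finset.card_image_of_injOn fun a ha b hb h =>
    huniq' a (Finset.mem_filter.1 ha).1 b (Finset.mem_filter.1 hb).1 (Or.inr h)
  have c3 : (M0.image Prod.fst).card = M0.card := Finset.card_image_of_injOn fun a ha b hb h =>
    huniq a (Finset.mem_filter.1 ha).1 b (Finset.mem_filter.1 hb).1 (Or.inl h)
  have c4 : (M0.image Prod.snd).card = M0.card := Finset.card_image_of_injOn fun a ha b hb h =>
    huniq a (Finset.mem_filter.1 ha).1 b (Finset.mem_filter.1 hb).1 (Or.inr h)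
  have l1 := Finset.card_le_card hP
  have l2 := Finset.card_le_card hQ
  have eP := Finset.eq_of_subset_of_card_le hP (by omega)
  have eQ := Finset.eq_of_subset_of_card_le hQ (by omega)
  have hM'ne : M'.Nonempty := by
    by_contra hcon
    have hall : ∀ q, ¬ (∃ p'', (p'', q) ∈ μ' ∧ I.WBelow μ₀ q p'') := by
      rintro q ⟨p, h1, h2⟩
      exact hcon ⟨(p, q), Finset.mem_filter.2 ⟨h1, h2⟩⟩
    exact hne (Finset.ext fun ⟨p, q⟩ => (hkeep q (hall q) p).symm)
  by_contra hgoal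
  -- every firm of `P'` has its best improving worker in `Q'`
  have hnext : ∀ p, ∃ s p2, p ∈ M'.image Prod.fst → ((p, s) ∈ I.E ∧ I.WBelow μ₀ s p ∧
      (∀ qt, (p, qt) ∈ I.E → I.WBelow μ₀ qt p → I.rankP p s ≤ I.rankP p qt) ∧
      (p2, s) ∈ μ₀ ∧ p2 ∈ M'.image Prod.fst) := by
    intro p
    by_cases hp : p ∈ M'.image Prod.fst
    swap
    · obtain ⟨e, -⟩ := hM'ne
      exact ⟨e.2, e.1, fun h => absurd h hp⟩
    obtain ⟨⟨p1, q1⟩, he, rfl⟩ := Finset.mem_image.1 hp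
    obtain ⟨he1, he2⟩ := Finset.mem_filter.1 he
    obtain ⟨⟨p3, s⟩, hs, hmin⟩ := Finset.exists_min_image
      (I.E.filter (fun e => e.1 = p1 ∧ I.WBelow μ₀ e.2 e.1)) (fun e => I.rankP p1 e.2)
      ⟨(p1, q1), Finset.mem_filter.2 ⟨hsub' he1, rfl, he2⟩⟩
    obtain ⟨hsE, hs1, hsW⟩ := Finset.mem_filter.1 hs
    simp only at hs1 hsW
    subst hs1
    have hmin' : ∀ qt, (p3, qt) ∈ I.E → I.WBelow μ₀ qt p3 → I.rankP p3 s ≤ I.rankP p3 qt :=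
      fun qt h1 h2 => hmin (p3, qt) (Finset.mem_filter.2 ⟨h1, rfl, h2⟩)
    have hsQ : ∃ p'', (p'', s) ∈ μ' ∧ I.WBelow μ₀ s p'' := by
      by_contra hcon
      refine hgoal ⟨p3, s, ⟨hsE, ?_, ?_⟩, ⟨q1, he1, he2⟩, hcon, ?_⟩
      · intro q' hq'
        have := fst1 he1 hq'
        subst this
        refine lt_of_le_of_ne (hmin' _ (hsub' he1) he2) fun heq => ?_
        have := I.injP _ _ _ hsE (hsub' he1) heq
        subst this
        exact hcon ⟨p3, he1, he2⟩
      · intro p' hp'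
        exact hsW p' ((hkeep s hcon p').2 hp')
      · rintro qt hqt ⟨-, h1, h2⟩
        exact absurd (hmin' qt hqt h2) (not_le.2 h1)
    obtain ⟨p4, h4, h5⟩ := hsQ
    have : s ∈ M0.image Prod.snd := by
      rw [eQ]
      exact Finset.mem_image.2 ⟨(p4, s), Finset.mem_filter.2 ⟨h4, h5⟩, rfl⟩
    obtain ⟨⟨p5, s'⟩, h6, rfl⟩ := Finset.mem_image.1 this
    refine ⟨s', p5, fun _ => ⟨hsE, hsW, hmin', (Finset.mem_filter.1 h6).1, ?_⟩⟩
    rw [eP]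
    exact Finset.mem_image.2 ⟨_, h6, rfl⟩
  choose s f hsf using hnext
  -- a minimal nonempty set of firms closed under `f`
  obtain ⟨C, hC, hCmin⟩ := Finset.exists_min_image
    ((M'.image Prod.fst).powerset.filter (fun C => C.Nonempty ∧ C.image f ⊆ C))
    Finset.card ⟨M'.image Prod.fst, Finset.mem_filter.2 ⟨Finset.mem_powerset_self _,
      hM'ne.image _, fun x hx => by
        obtain ⟨y, hy, rfl⟩ := Finset.mem_image.1 hx
        exact (hsf y hy).2.2.2.2⟩⟩
  obtain ⟨hCP, hCne, hCcl⟩ := Finset.mem_filter.1 hC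
  rw [Finset.mem_powerset] at hCP
  have hcard := hCmin (C.image f) (Finset.mem_filter.2
    ⟨Finset.mem_powerset.2 (hCcl.trans hCP), hCne.image _, Finset.image_subset_image hCcl⟩)
  have himg : C.image f = C := Finset.eq_of_subset_of_card_le hCcl hcard
  have hinj : Set.InjOn f C := Finset.card_image_iff.1 (by rw [himg])
  let ν : Finset (P × Q) := μ₀.filter (fun e => e.1 ∉ C) ∪ C.image (fun p => (p, s p))
  have hν : ∀ p q, (p, q) ∈ ν ↔ ((p, q) ∈ μ₀ ∧ p ∉ C) ∨ (p ∈ C ∧ s p = q) := by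
    intro p q
    simp only [ν, Finset.mem_union, Finset.mem_filter, Finset.mem_image, Prod.mk.injEq]
    constructor
    · rintro (h | ⟨a, ha, rfl, h⟩)
      · exact Or.inl h
      · exact Or.inr ⟨ha, h⟩
    · rintro (h | ⟨ha, h⟩)
      · exact Or.inl h
      · exact Or.inr ⟨p, ha, rfl, h⟩
  have hfC : ∀ p ∈ C, f p ∈ C := fun p hp => hCcl (Finset.mem_image_of_mem f hp)
  have hνst : I.IsStable ν := by
    refine ⟨⟨?_, ?_⟩, ?_⟩
    · rintro ⟨p, q⟩ hh
      rcases (hν p q).1 hh with ⟨h, -⟩ | ⟨h, rfl⟩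
      · exact hsub h
      · exact (hsf p (hCP h)).1
    · rintro ⟨p, q⟩ hh ⟨p', q'⟩ hh' hor
      simp only at hor
      rcases (hν p q).1 hh with ⟨h, hn⟩ | ⟨h, rfl⟩ <;>
      rcases (hν p' q').1 hh' with ⟨h', hn'⟩ | ⟨h', rfl⟩
      · exact huniq _ h _ h' hor
      · rcases hor with rfl | rfl
        · exact absurd h' hn
        · exact absurd (snd0 h (hsf p' (hCP h')).2.2.2.1 ▸ hfC p' h') hn
      · rcases hor with rfl | rfl
        · exact absurd h hn'
        · exact absurd (snd0 h' (hsf p (hCP h)).2.2.2.1 ▸ hfC p h) hn'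
      · rcases hor with rfl | hor
        · rfl
        · have h1 := (hsf p (hCP h)).2.2.2.1
          rw [hor] at h1
          have := hinj h h' (snd0 h1 (hsf p' (hCP h')).2.2.2.1)
          subst this
          rfl
    · rintro ⟨p, q⟩ ⟨hE, hF, hW⟩
      simp only at hF hW
      have hW0 : I.WBelow μ₀ q p := by
        intro p' hp'
        by_cases hc : p' ∈ C
        · rw [← himg] at hc
          obtain ⟨p3, h3, rfl⟩ := Finset.mem_image.1 hc
          have h4 := hsf p3 (hCP h3)
          have h5 : s p3 = q := fst0 h4.2.2.2.1 hp'
          have h6 := h4.2.1 _ h4.2.2.2.1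
          rw [h5] at h6
          exact (hW p3 ((hν _ _).2 (Or.inr ⟨h3, h5⟩))).trans h6
        · exact hW p' ((hν _ _).2 (Or.inl ⟨hp', hc⟩))
      by_cases hc : p ∈ C
      · exact absurd (hF (s p) ((hν _ _).2 (Or.inr ⟨hc, rfl⟩)))
          (not_lt.2 ((hsf p (hCP hc)).2.2.1 q hE hW0))
      · exact hstab (p, q) ⟨hE, fun q' hq' => hF q' ((hν _ _).2 (Or.inl ⟨hq', hc⟩)), hW0⟩
  obtain ⟨p, hp⟩ := hCne
  have hw := (hsf p (hCP hp)).2.1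
  obtain ⟨p', hp', rfl | hlt⟩ := hopt ν hνst (s p) p ((hν _ _).2 (Or.inr ⟨hp, rfl⟩))
  · exact lt_irrefl _ (hw _ hp')
  · exact lt_asymm hlt (hw _ hp')

end MI

end SeqMatching
end

section
/- Let I be a matching instance in which, for every pair (p,q) ∈ qopt(I), the worker q is the most preferred worker on p's list, and suppose qopt(I) is nonempty. Then there exists a pair e* ∈ qopt(I) such that qopt(I/e*) = qopt(I) − {e*}, i.e., contracting e* leaves the Q-optimal stable matching of the contracted instance equal to the remaining pairs of qopt(I). -/
namespace SeqMatching

namespace MI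

variable {P Q : Type}

variable [DecidableEq P] [DecidableEq Q]

/-- in the stable matching `μ`, the best worker for the firm of `e` that would prefer that firm
to her partner in `μ` is the worker of `f`. -/
def Step (I : MI P Q) (μ : Finset (P × Q)) (e f : P × Q) : Prop :=
  (e.1, f.2) ∈ I.E ∧ I.rankQ f.2 e.1 < I.rankQ f.2 f.1 ∧
    ∀ q', (e.1, q') ∈ I.E → I.WBelow μ q' e.1 → I.rankP e.1 f.2 ≤ I.rankP e.1 q'

theorem wbelow_of_mem {I : MI P Q} {μ : Finset (P × Q)} (hμ : I.IsMatching μ) {f : P × Q}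
    (hf : f ∈ μ) {p : P} (h : I.rankQ f.2 p < I.rankQ f.2 f.1) : I.WBelow μ f.2 p := by
  intro x hx
  have := hμ.2 _ hx _ hf (Or.inr rfl)
  rw [← this] at h
  exact h

theorem step_unique {I : MI P Q} {μ : Finset (P × Q)} (hμ : I.IsMatching μ) {e f f' : P × Q}
    (hf : f ∈ μ) (hf' : f' ∈ μ) (h : I.Step μ e f) (h' : I.Step μ e f') : f = f' := by
  obtain ⟨h1, h2, h3⟩ := h
  obtain ⟨h1', h2', h3'⟩ := h'
  have a := h3 _ h1' (wbelow_of_mem hμ hf' h2')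
  have b := h3' _ h1 (wbelow_of_mem hμ hf h2)
  exact hμ.2 _ hf _ hf' (Or.inr (I.injP _ _ _ h1 h1' (le_antisymm a b)))

theorem no_rotation (I : MI P Q) (μ : Finset (P × Q)) (h₀ : I.IsQOpt μ) (C : Finset (P × Q))
    (hC : C ⊆ μ) (hne : C.Nonempty) (hpred : ∀ f ∈ C, ∃ e ∈ C, I.Step μ e f) : False := by
  have hμ := h₀.1.1
  choose! g hgC hg using hpred
  have ginj : Set.InjOn g C := by
    intro f hf f' hf' hh
    refine step_unique hμ (hC hf) (hC hf') (hg f hf) ?_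
    rw [hh]; exact hg f' hf'
  have gsurj : ∀ e ∈ C, ∃ f ∈ C, g f = e := by
    intro e he
    have : C.image g = C := Finset.eq_of_subset_of_card_le
      (Finset.image_subset_iff.2 hgC) (by rw [Finset.card_image_of_injOn ginj])
    rw [← this] at he
    simpa using he
  let ν := (μ \ C) ∪ C.image (fun f => ((g f).1, f.2))
  have hν : ∀ d, d ∈ ν ↔ (d ∈ μ ∧ d ∉ C) ∨ ∃ f ∈ C, ((g f).1, f.2) = d := by
    intro d; simp [ν]
  have hst : I.IsStable ν := by
    refine ⟨⟨?_, ?_⟩, ?_⟩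
    · intro d hd
      rcases (hν d).1 hd with h | ⟨f, hf, rfl⟩
      · exact hμ.1 h.1
      · exact (hg f hf).1
    · intro d hd d' hd' hh
      rcases (hν d).1 hd with h | ⟨f, hf, rfl⟩ <;> rcases (hν d').1 hd' with h' | ⟨f', hf', rfl⟩
      · exact hμ.2 _ h.1 _ h'.1 hh
      · exfalso
        rcases hh with hh | hh
        · exact h.2 (hμ.2 _ h.1 _ (hC (hgC _ hf')) (Or.inl hh) ▸ hgC _ hf')
        · exact h.2 (hμ.2 _ h.1 _ (hC hf') (Or.inr hh) ▸ hf')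
      · exfalso
        rcases hh with hh | hh
        · exact h'.2 (hμ.2 _ h'.1 _ (hC (hgC _ hf)) (Or.inl hh.symm) ▸ hgC _ hf)
        · exact h'.2 (hμ.2 _ h'.1 _ (hC hf) (Or.inr hh.symm) ▸ hf)
      · have : f = f' := by
          rcases hh with hh | hh
          · exact ginj hf hf' (hμ.2 _ (hC (hgC _ hf)) _ (hC (hgC _ hf')) (Or.inl hh))
          · exact hμ.2 _ (hC hf) _ (hC hf') (Or.inr hh)
        rw [this]
    · rintro ⟨p, q⟩ ⟨hE, hF, hW⟩
      simp only at hF hW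
      have hW' : I.WBelow μ q p := by
        intro x hx
        by_cases hxC : (x, q) ∈ C
        · have h1 := hW (g (x, q)).1 ((hν _).2 (Or.inr ⟨_, hxC, rfl⟩))
          have h2 := (hg _ hxC).2.1
          exact h1.trans h2
        · exact hW x ((hν _).2 (Or.inl ⟨hx, hxC⟩))
      refine h₀.1.2 (p, q) ⟨hE, ?_, hW'⟩
      intro q1 hq1
      by_cases hxC : (p, q1) ∈ C
      · exfalso
        obtain ⟨f, hf, hgf⟩ := gsurj _ hxC
        have h1 := hF f.2 ((hν _).2 (Or.inr ⟨f, hf, by rw [hgf]⟩))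
        have h2 := (hg f hf).2.2 q
        rw [hgf] at h2
        exact absurd (h2 hE hW') (not_le.2 h1)
      · exact hF q1 ((hν _).2 (Or.inl ⟨hq1, hxC⟩))
  obtain ⟨f, hf⟩ := hne
  obtain ⟨p', hp', h⟩ := h₀.2 ν hst f.2 (g f).1 ((hν _).2 (Or.inr ⟨f, hf, rfl⟩))
  have hpf : (p', f.2) = f := hμ.2 _ hp' _ (hC hf) (Or.inr rfl)
  have : p' = f.1 := by rw [← hpf]
  subst this
  have h2 := (hg f hf).2.1
  rcases h with h | h
  · rw [h] at h2; exact lt_irrefl _ h2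
  · exact lt_asymm h h2

/-- a nonempty subset closed under a successor contains one closed under predecessors. -/
theorem no_closed (I : MI P Q) (μ : Finset (P × Q)) (h₀ : I.IsQOpt μ) (n : ℕ) :
    ∀ F : Finset (P × Q), F.card = n → F ⊆ μ → F.Nonempty →
      (∀ e ∈ F, ∃ f ∈ F, I.Step μ e f) → False := by
  induction n using Nat.strong_induction_on with
  | _ n ih =>
    intro F hn hF hne hs
    choose! s hsF hs using hs
    have hsub : F.image s ⊆ F := Finset.image_subset_iff.2 hsF
    by_cases heq : F.image s = F
    · refine no_rotation I μ h₀ F hF hne ?_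
      intro f hf
      rw [← heq] at hf
      obtain ⟨e, he, rfl⟩ := Finset.mem_image.1 hf
      exact ⟨e, he, hs e he⟩
    · refine ih _ ?_ (F.image s) rfl (hsub.trans hF) (hne.image s) ?_
      · rw [← hn]
        exact Finset.card_lt_card (lt_of_le_of_ne hsub heq)
      · intro e he
        exact ⟨s e, Finset.mem_image_of_mem _ (hsub he), hs e (hsub he)⟩

/-- if for every pair of `qopt(I)` the worker is the most preferred on the
firm's list and `qopt(I)` is nonempty, then some `e* ∈ qopt(I)` satisfies
`qopt(I/e*) = qopt(I) − e*`. -/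
theorem stmt_13 (P Q : Type) [DecidableEq P] [DecidableEq Q] (I : MI P Q)
    (μ₀ : Finset (P × Q)) (h₀ : I.IsQOpt μ₀)
    (htop : ∀ e ∈ μ₀, I.TopForFirm e.1 e.2)
    (hne : μ₀.Nonempty) :
    ∃ e ∈ μ₀, (I.contr e).IsQOpt (μ₀.erase e) := by
  classical
  have hμ := h₀.1.1
  obtain ⟨e, he, hsrc⟩ : ∃ e ∈ μ₀, ∀ f ∈ μ₀, ¬ I.Step μ₀ f e := by
    by_contra hcon
    push Not at hcon
    exact no_rotation I μ₀ h₀ μ₀ subset_rfl hne hcon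
  have hcE : ∀ p q, (p, q) ∈ (I.contr e).E ↔ (p, q) ∈ I.E ∧ p ≠ e.1 ∧ q ≠ e.2 := by
    intro p q; simp [contr]
  have hwb : ∀ q p, q ≠ e.2 → (I.WBelow (μ₀.erase e) q p ↔ I.WBelow μ₀ q p) := by
    intro q p hq
    refine ⟨fun h x hx => h x (Finset.mem_erase.2 ⟨?_, hx⟩),
      fun h x hx => h x (Finset.mem_of_mem_erase hx)⟩
    rintro rfl; exact hq rfl
  have hfb : ∀ p q, p ≠ e.1 → (I.FBelow (μ₀.erase e) p q ↔ I.FBelow μ₀ p q) := by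
    intro q p hq
    refine ⟨fun h x hx => h x (Finset.mem_erase.2 ⟨?_, hx⟩),
      fun h x hx => h x (Finset.mem_of_mem_erase hx)⟩
    rintro rfl; exact hq rfl
  refine ⟨e, he, ⟨⟨?_, ?_⟩, ?_⟩, ?_⟩
  · rintro ⟨p, q⟩ hd
    obtain ⟨hd1, hd2⟩ := Finset.mem_erase.1 hd
    refine (hcE p q).2 ⟨hμ.1 hd2, ?_, ?_⟩
    · intro hp; exact hd1 (hμ.2 _ hd2 _ he (Or.inl hp))
    · intro hq; exact hd1 (hμ.2 _ hd2 _ he (Or.inr hq))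
  · intro d hd d' hd' hh
    exact hμ.2 _ (Finset.mem_of_mem_erase hd) _ (Finset.mem_of_mem_erase hd') hh
  · rintro ⟨p, q⟩ ⟨hE, hF, hW⟩
    obtain ⟨hE, hp, hq⟩ := (hcE p q).1 hE
    exact h₀.1.2 (p, q) ⟨hE, (hfb p q hp).1 hF, (hwb q p hq).1 hW⟩
  intro μ' hμ' q0 p0 hpq0
  by_contra hcon
  have hM' := hμ'.1
  let D := μ'.filter (fun d => I.WBelow μ₀ d.2 d.1)
  have hD : ∀ d, d ∈ D ↔ d ∈ μ' ∧ I.WBelow μ₀ d.2 d.1 := by intro d; simp [D]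
  have hsub' : ∀ p q, (p, q) ∈ μ' → (p, q) ∈ I.E ∧ p ≠ e.1 ∧ q ≠ e.2 :=
    fun p q h => (hcE p q).1 (hM'.1 h)
  have hd0 : (p0, q0) ∈ D := by
    have h0 := hsub' _ _ hpq0
    refine (hD _).2 ⟨hpq0, (hwb _ _ h0.2.2).1 ?_⟩
    intro x hx
    by_contra hlt
    refine hcon ⟨x, hx, ?_⟩
    rcases (not_lt.1 hlt).lt_or_eq with h | h
    · exact Or.inr h
    · exact Or.inl (I.injQ _ _ _ (hμ.1 (Finset.mem_of_mem_erase hx)) h0.1 h)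
  have hnext : ∀ d ∈ D, ∃ d' ∈ D, (d.1, d'.2) ∈ μ₀ := by
    rintro ⟨p, q⟩ hd
    obtain ⟨hd1, hd2⟩ := (hD _).1 hd
    obtain ⟨hE, hp, hq⟩ := hsub' _ _ hd1
    have hnF : ¬ I.FBelow μ₀ p q := fun h => h₀.1.2 (p, q) ⟨hE, h, hd2⟩
    unfold FBelow at hnF
    push Not at hnF
    obtain ⟨q1, hq1, hle⟩ := hnF
    have hq1E := hμ.1 hq1
    have hne1 : q1 ≠ q := by
      rintro rfl
      exact lt_irrefl _ (hd2 p hq1)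
    have hq1e : q1 ≠ e.2 := by
      intro h
      exact hp (congrArg Prod.fst (hμ.2 _ hq1 _ he (Or.inr h)))
    have hlt : I.rankP p q1 < I.rankP p q :=
      lt_of_le_of_ne hle (fun h => hne1 (I.injP _ _ _ hq1E hE h))
    have hnB : ¬ I.WBelow μ' q1 p := by
      intro hW
      refine hμ'.2 (p, q1) ⟨(hcE _ _).2 ⟨hq1E, hp, hq1e⟩, ?_, hW⟩
      intro q2 hq2
      have : (p, q2) = (p, q) := hM'.2 _ hq2 _ hd1 (Or.inl rfl)
      rw [(Prod.mk.inj this).2]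
      exact hlt
    unfold WBelow at hnB
    push Not at hnB
    obtain ⟨x, hx, hxle⟩ := hnB
    have hxE := hsub' _ _ hx
    have hxp : x ≠ p := by
      rintro rfl
      exact hne1 (congrArg Prod.snd (hM'.2 _ hx _ hd1 (Or.inl rfl)))
    refine ⟨(x, q1), (hD _).2 ⟨hx, ?_⟩, hq1⟩
    exact wbelow_of_mem hμ (f := (p, q1)) hq1
      (lt_of_le_of_ne hxle (fun h => hxp (I.injQ _ _ _ hxE.1 hq1E h)))
  choose! t htD ht using hnext
  have tinj : Set.InjOn t D := by
    intro d hd d' hd' hh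
    have h1 := ht d hd
    have h2 := ht d' hd'
    rw [hh] at h1
    have h3 := congrArg Prod.fst (hμ.2 _ h1 _ h2 (Or.inr rfl))
    exact hM'.2 _ ((hD _).1 hd).1 _ ((hD _).1 hd').1 (Or.inl h3)
  have tsurj : ∀ d' ∈ D, ∃ d ∈ D, t d = d' := by
    intro d' hd'
    have : D.image t = D := Finset.eq_of_subset_of_card_le
      (Finset.image_subset_iff.2 htD) (by rw [Finset.card_image_of_injOn tinj])
    rw [← this] at hd'
    simpa using hd'
  let F := D.image (fun d => (d.1, (t d).2))
  refine no_closed I μ₀ h₀ _ F rfl ?_ ⟨_, Finset.mem_image_of_mem _ hd0⟩ ?_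
  · exact Finset.image_subset_iff.2 ht
  intro a ha
  obtain ⟨d, hd, rfl⟩ := Finset.mem_image.1 ha
  obtain ⟨p, q⟩ := d
  obtain ⟨hd1, hd2⟩ := (hD _).1 hd
  obtain ⟨hE, hp, hq⟩ := hsub' _ _ hd1
  simp only at hd2
  let cand := (I.E.filter (fun f => f.1 = p ∧ I.WBelow μ₀ f.2 p))
  have hcand : ∀ f, f ∈ cand ↔ f ∈ I.E ∧ f.1 = p ∧ I.WBelow μ₀ f.2 p := by
    intro f; simp [cand]
  obtain ⟨⟨p1, s⟩, hs, hmin⟩ := Finset.exists_min_image cand (fun f => I.rankP p f.2)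
    ⟨(p, q), (hcand _).2 ⟨hE, rfl, hd2⟩⟩
  obtain ⟨hsE, hp1, hsW⟩ := (hcand _).1 hs
  simp only at hp1 hsW hmin
  subst hp1
  have hmin' : ∀ q', (p1, q') ∈ I.E → I.WBelow μ₀ q' p1 → I.rankP p1 s ≤ I.rankP p1 q' :=
    fun q' h1 h2 => hmin (p1, q') ((hcand _).2 ⟨h1, rfl, h2⟩)
  have hse : s ≠ e.2 := by
    rintro rfl
    exact hsrc _ (ht _ hd) ⟨hsE, hsW _ he, hmin'⟩
  have hsD : ∃ x, (x, s) ∈ D := by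
    by_contra hno
    have hsq : s ≠ q := by
      rintro rfl; exact hno ⟨_, hd⟩
    refine hμ'.2 (p1, s) ⟨(hcE _ _).2 ⟨hsE, hp, hse⟩, ?_, ?_⟩
    · intro q2 hq2
      have : (p1, q2) = (p1, q) := hM'.2 _ hq2 _ hd1 (Or.inl rfl)
      rw [(Prod.mk.inj this).2]
      exact lt_of_le_of_ne (hmin' q hE hd2) (fun h => hsq (I.injP _ _ _ hsE hE h))
    · intro x hx
      have hnW : ¬ I.WBelow μ₀ s x := fun h => hno ⟨x, (hD _).2 ⟨hx, h⟩⟩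
      unfold WBelow at hnW
      push Not at hnW
      obtain ⟨y, hy, hyx⟩ := hnW
      exact lt_of_lt_of_le (hsW y hy) hyx
  obtain ⟨x, hx⟩ := hsD
  obtain ⟨d', hd', htd'⟩ := tsurj _ hx
  have hmem := ht d' hd'
  rw [htd'] at hmem
  refine ⟨(d'.1, s), Finset.mem_image.2 ⟨d', hd', by rw [htd']⟩, hsE, hsW _ hmem, hmin'⟩

end MI

end SeqMatching
end

section
/- Let (I,σ) be a sequential matching game and μ = spe(I,σ). If a pair (p,q) ∈ E blocks μ (i.e., q ≻_p μ(p) and p ≻_q μ(q)), then q is matched in μ and σ^{-1}((p,q)) > σ^{-1}((μ(q),q)), i.e., the offer (p,q) comes strictly later in σ than the offer by which q is matched. -/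
namespace SeqMatching

namespace MI

variable {P Q : Type}

variable [DecidableEq P] [DecidableEq Q]

theorem idxOf_filter_lt {α : Type} [BEq α] [LawfulBEq α] (f : α → Bool) (a b : α)
    (ha : f a = true) (hb : f b = true) (l : List α) :
    (l.filter f).idxOf a < (l.filter f).idxOf b ↔ l.idxOf a < l.idxOf b := by
  induction l with
  | nil => simp
  | cons x l ih =>
    by_cases hx : f x = true
    · rw [List.filter_cons_of_pos hx]
      by_cases h1 : x = a
      · by_cases h2 : x = b
        · subst h1; subst h2; simp
        · subst h1
          rw [List.idxOf_cons_ne _ h2, List.idxOf_cons_ne _ h2]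
          simp
      · by_cases h2 : x = b
        · subst h2
          simp
        · rw [List.idxOf_cons_ne _ h1, List.idxOf_cons_ne _ h1,
            List.idxOf_cons_ne _ h2, List.idxOf_cons_ne _ h2]
          omega
    · have h1 : x ≠ a := by rintro rfl; exact hx ha
      have h2 : x ≠ b := by rintro rfl; exact hx hb
      rw [List.filter_cons_of_neg hx]
      rw [List.idxOf_cons_ne _ h1, List.idxOf_cons_ne _ h2]
      omega

theorem offer_del (I : MI P Q) (e : P × Q) (l : List (P × Q))
    (h : I.IsOfferOrder (e :: l)) : (I.del e).IsOfferOrder l := by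
  obtain ⟨hn, hm, ho⟩ := h
  have hn' := List.nodup_cons.mp hn
  refine ⟨hn'.2, ?_, ?_⟩
  · intro f
    have := hm f
    simp only [del, Finset.mem_erase, ← this, List.mem_cons]
    constructor
    · intro hf
      exact ⟨by rintro rfl; exact hn'.1 hf, Or.inr hf⟩
    · rintro ⟨h1, h2⟩
      exact h2.resolve_left h1
  · intro f g hf hg h1 h2
    have := ho f g (List.mem_cons_of_mem _ hf) (List.mem_cons_of_mem _ hg) h1 h2
    have hfe : e ≠ f := by rintro rfl; exact hn'.1 hf
    have hge : e ≠ g := by rintro rfl; exact hn'.1 hg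
    rw [List.idxOf_cons_ne _ hfe, List.idxOf_cons_ne _ hge] at this
    omega

theorem offer_contr (I : MI P Q) (e : P × Q) (l : List (P × Q))
    (h : I.IsOfferOrder (e :: l)) : (I.contr e).IsOfferOrder (contrO l e) := by
  obtain ⟨hn, hm, ho⟩ := offer_del I e l h
  refine ⟨hn.filter _, ?_, ?_⟩
  · intro f
    have := hm f
    simp only [del, Finset.mem_erase] at this
    simp only [contrO, contr, List.mem_filter, Finset.mem_filter, decide_eq_true_eq, this]
    constructor
    · rintro ⟨⟨_, h1⟩, h2⟩
      exact ⟨h1, h2⟩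
    · rintro ⟨h1, h2⟩
      exact ⟨⟨by rintro rfl; exact h2.1 rfl, h1⟩, h2⟩
  · intro f g hf hg h1 h2
    have hf' := List.mem_filter.mp hf
    have hg' := List.mem_filter.mp hg
    exact (idxOf_filter_lt (fun f : P × Q => decide (f.1 ≠ e.1 ∧ f.2 ≠ e.2)) f g hf'.2 hg'.2 l).mpr (ho f g hf'.1 hg'.1 h1 h2)

theorem main_aux (n : ℕ) : ∀ (I : MI P Q) (σ : List (P × Q)), σ.length ≤ n →
    I.IsOfferOrder σ → ∀ (p : P) (q : Q), I.Blocks (I.spe σ) (p, q) →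
    ∃ p', (p', q) ∈ I.spe σ ∧ σ.idxOf (p', q) < σ.idxOf (p, q) := by
  induction n with
  | zero =>
    intro I σ hl hσ p q hb
    have : σ = [] := List.length_eq_zero_iff.mp (by omega)
    subst this
    exact absurd ((hσ.2.1 _).mpr hb.1) (by simp)
  | succ n ih =>
    intro I σ hl hσ p q hb
    match σ, hl, hσ, hb with
    | [], _, hσ, hb => exact absurd ((hσ.2.1 _).mpr hb.1) (by simp)
    | e :: l, hl, hσ, hb =>
      have hll : l.length ≤ n := by simpa using hl
      obtain ⟨hE, hF, hW⟩ := hb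
      rw [spe] at hF hW ⊢
      split_ifs at hF hW ⊢ with hc
      · by_cases hp : p = e.1
        · subst hp
          have h1 := hF e.2 (Finset.mem_insert_self _ _)
          have h2 := hσ.2.2 (e.1, q) e ((hσ.2.1 _).mpr hE) List.mem_cons_self rfl h1
          simp at h2
        · have hne : e ≠ (p, q) := by rintro rfl; exact hp rfl
          by_cases hq : q = e.2
          · subst hq
            refine ⟨e.1, Finset.mem_insert_self _ _, ?_⟩
            rw [List.idxOf_cons_ne _ hne]
            simp
          · obtain ⟨p', h1, h2⟩ := ih (I.contr e) (contrO l e)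
              ((List.length_filter_le _ _).trans hll) (offer_contr I e l hσ) p q
              ⟨Finset.mem_filter.mpr ⟨hE, hp, hq⟩,
                fun q' h => hF q' (Finset.mem_insert_of_mem h),
                fun p' h => hW p' (Finset.mem_insert_of_mem h)⟩
            refine ⟨p', Finset.mem_insert_of_mem h1, ?_⟩
            have hne' : e ≠ (p', q) := by rintro rfl; exact hq rfl
            have hmem : (p', q) ∈ contrO l e := by
              rw [← List.idxOf_lt_length_iff]
              exact lt_of_lt_of_le h2 List.idxOf_le_length
            have h3 := (idxOf_filter_lt (fun f : P × Q => decide (f.1 ≠ e.1 ∧ f.2 ≠ e.2)) (p', q) (p, q)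
              (List.mem_filter.mp hmem).2
              (by simp [hp, hq]) l).mp h2
            rw [List.idxOf_cons_ne _ hne, List.idxOf_cons_ne _ hne']
            omega
      · have hne : e ≠ (p, q) := by rintro rfl; exact hc hW
        obtain ⟨p', h1, h2⟩ := ih (I.del e) l hll (offer_del I e l hσ) p q
          ⟨Finset.mem_erase.mpr ⟨hne.symm, hE⟩, hF, hW⟩
        refine ⟨p', h1, ?_⟩
        rw [List.idxOf_cons_ne _ hne]
        by_cases hne' : e = (p', q)
        · subst hne'; simp
        · rw [List.idxOf_cons_ne _ hne']
          omega

/-- if `(p, q)` blocks `spe(I, σ)`, then `q` is matched in `spe(I, σ)` and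
the offer `(p, q)` comes strictly later in `σ` than the offer `(spe(I,σ)(q), q)`. -/
theorem stmt_14 (P Q : Type) [DecidableEq P] [DecidableEq Q] (I : MI P Q)
    (σ : List (P × Q)) (hσ : I.IsOfferOrder σ) (p : P) (q : Q)
    (hb : I.Blocks (I.spe σ) (p, q)) :
    ∃ p', (p', q) ∈ I.spe σ ∧ σ.idxOf (p', q) < σ.idxOf (p, q) := by
  exact main_aux σ.length I σ le_rfl hσ p q hb

end MI

end SeqMatching
end

section
/- Let (I,σ) be a sequential matching game and (p,q) ∈ E a pair such that q is the most preferred worker on p's list (q ⪰_p q' for every q' ∈ Γ(p)). Then spe(I,σ)(q) ⪰_q p, i.e., in the SPE matching the worker q is matched to p or to a firm she prefers to p. -/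
namespace SeqMatching

namespace MI

variable {P Q : Type}

variable [DecidableEq P] [DecidableEq Q]

theorem spe_mem_aux (n : ℕ) : ∀ (I : MI P Q) (σ : List (P × Q)), σ.length ≤ n →
    ∀ f ∈ I.spe σ, f ∈ σ := by
  induction n with
  | zero =>
    intro I σ hn f hf
    have : σ = [] := List.length_eq_zero_iff.mp (by omega)
    subst this
    simp [spe] at hf
  | succ n ih =>
    intro I σ hn f hf
    cases σ with
    | nil => simp [spe] at hf
    | cons e rest =>
      have hr : rest.length ≤ n := by simpa using hn
      rw [spe] at hf
      split at hf
      · rcases Finset.mem_insert.mp hf with h | h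
        · simp [h]
        · have := ih (I.contr e) (contrO rest e)
            (le_trans (List.length_filter_le _ _) hr) f h
          exact List.mem_cons_of_mem _ (List.mem_filter.mp this).1
      · exact List.mem_cons_of_mem _ (ih _ _ hr f hf)

theorem spe_top_aux (p : P) (q : Q) (n : ℕ) : ∀ (I : MI P Q) (σ : List (P × Q)), σ.length ≤ n →
    (p, q) ∈ σ →
    σ.Pairwise (fun a b => b = (p, q) → a.1 ≠ p) →
    (∀ p', (p', q) ∈ σ → I.rankQ q p' = I.rankQ q p → p' = p) →
    I.WAtLeast (I.spe σ) q p := by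
  induction n with
  | zero =>
    intro I σ hn hm
    have : σ = [] := List.length_eq_zero_iff.mp (by omega)
    subst this
    simp at hm
  | succ n ih =>
    intro I σ hn hm hp hinj
    cases σ with
    | nil => simp at hm
    | cons e rest =>
      have hr : rest.length ≤ n := by simpa using hn
      rw [List.pairwise_cons] at hp
      obtain ⟨hp1, hp2⟩ := hp
      rw [spe]
      by_cases he : (p, q) = e
      · subst he
        split
        · exact ⟨p, Finset.mem_insert_self _ _, Or.inl rfl⟩
        · next hw =>
          simp only [WBelow, not_forall, not_lt] at hw
          obtain ⟨p', hp', hle⟩ := hw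
          refine ⟨p', hp', ?_⟩
          rcases hle.lt_or_eq with h | h
          · exact Or.inr h
          · exact Or.inl (hinj p' (List.mem_cons_of_mem _ (spe_mem_aux _ _ _ le_rfl _ hp')) h)
      · have hm' : (p, q) ∈ rest := by
          rcases List.mem_cons.mp hm with h | h
          · exact absurd h he
          · exact h
        have hne : e.1 ≠ p := hp1 _ hm' rfl
        obtain ⟨p', hp', hor⟩ := ih (I.del e) rest hr hm' hp2
          (fun p' h => hinj p' (List.mem_cons_of_mem _ h))
        split
        · next hw =>
          by_cases hq : e.2 = q
          · refine ⟨e.1, Finset.mem_insert.mpr (Or.inl (by rw [← hq])), Or.inr ?_⟩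
            rw [hq] at hw
            have h1 := hw p' hp'
            rcases hor with rfl | h
            · exact h1
            · exact lt_trans h1 h
          · obtain ⟨p'', h1, h2⟩ := ih (I.contr e) (contrO rest e)
              (le_trans (List.length_filter_le _ _) hr)
              (List.mem_filter.mpr ⟨hm', by simp [Ne.symm hne, Ne.symm hq]⟩)
              (hp2.filter _)
              (fun p' h => hinj p' (List.mem_cons_of_mem _ (List.mem_filter.mp h).1))
            exact ⟨p'', Finset.mem_insert_of_mem h1, h2⟩
        · exact ⟨p', hp', hor⟩

/-- if `q` is on the top of `p`'s list, then `spe(I, σ)(q) ⪰_q p`. -/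
theorem stmt_15 (P Q : Type) [DecidableEq P] [DecidableEq Q] (I : MI P Q)
    (σ : List (P × Q)) (hσ : I.IsOfferOrder σ) (p : P) (q : Q)
    (htop : I.TopForFirm p q) :
    I.WAtLeast (I.spe σ) q p := by
  obtain ⟨hnd, hmem, hord⟩ := hσ
  obtain ⟨hpq, hmin⟩ := htop
  refine spe_top_aux p q _ I σ le_rfl ((hmem _).mpr hpq) ?_
    (fun p' h hr => I.injQ q p' p ((hmem _).mp h) hpq hr)
  rw [List.pairwise_iff_getElem]
  intro i j hi hj hij hje hip
  have hmi : σ[i] ∈ σ := List.getElem_mem hi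
  have hmj : σ[j] ∈ σ := List.getElem_mem hj
  have hE : (p, σ[i].2) ∈ I.E := by
    rw [← hip]; exact (hmem _).mp hmi
  have hlt : I.rankP p q < I.rankP p σ[i].2 := by
    refine lt_of_le_of_ne (hmin _ hE) (fun h => ?_)
    have hq := I.injP p q _ hpq hE h
    have : σ[i] = σ[j] := by
      rw [hje]; exact Prod.ext hip hq.symm
    have := (hnd.getElem_inj_iff).mp this
    omega
  have := hord σ[j] σ[i] hmj hmi (by rw [hje, hip]) (by rw [hje, hip]; exact hlt)
  rw [hnd.idxOf_getElem, hnd.idxOf_getElem] at this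
  omega

end MI

end SeqMatching
end

section
/- Let (I,σ) be a sequential matching game and e=(p,q) ∈ E a pair such that q is the most preferred worker of p and p is the most preferred firm of q. Then spe(I,σ)=spe(I/e,σ/e)+e; in particular, the top-top pair e is matched in the SPE matching. -/
namespace SeqMatching

namespace MI

variable {P Q : Type}

variable [DecidableEq P] [DecidableEq Q]

theorem spe_nil' (I : MI P Q) : I.spe [] = ∅ := by
  rw [spe]

open scoped Classical in
theorem spe_cons' (I : MI P Q) (e : P × Q) (rest : List (P × Q)) :
    I.spe (e :: rest) = if I.WBelow ((I.del e).spe rest) e.2 e.1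
    then insert e ((I.contr e).spe (contrO rest e))
    else (I.del e).spe rest := by
  rw [spe]

theorem contrO_length_le (σ : List (P × Q)) (e : P × Q) : (contrO σ e).length ≤ σ.length :=
  List.length_filter_le _ _

/-- `spe` depends on the instance only through the workers' ranks. -/
theorem spe_congr (n : ℕ) : ∀ (σ : List (P × Q)), σ.length ≤ n → ∀ (I J : MI P Q),
    I.rankQ = J.rankQ → I.spe σ = J.spe σ := by
  induction n with
  | zero =>
    intro σ hσ I J h
    have : σ = [] := List.length_eq_zero_iff.mp (by omega)
    subst this
    rw [spe_nil', spe_nil']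
  | succ n ih =>
    intro σ hσ I J h
    cases σ with
    | nil => rw [spe_nil', spe_nil']
    | cons f rest =>
      have hr : rest.length ≤ n := by simpa using hσ
      rw [spe_cons', spe_cons', ih rest hr (I.del f) (J.del f) h,
        ih (contrO rest f) ((contrO_length_le rest f).trans hr) (I.contr f) (J.contr f) h]
      have hiff : I.WBelow ((J.del f).spe rest) f.2 f.1 ↔
          J.WBelow ((J.del f).spe rest) f.2 f.1 := by
        unfold WBelow
        rw [h]
      by_cases hw : J.WBelow ((J.del f).spe rest) f.2 f.1
      · rw [if_pos hw, if_pos (hiff.mpr hw)]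
      · rw [if_neg hw, if_neg (fun h => hw (hiff.mp h))]

theorem spe_mem (n : ℕ) : ∀ (σ : List (P × Q)), σ.length ≤ n → ∀ (I : MI P Q),
    ∀ x ∈ I.spe σ, x ∈ σ := by
  induction n with
  | zero =>
    intro σ hσ I x hx
    have : σ = [] := List.length_eq_zero_iff.mp (by omega)
    subst this
    rw [spe_nil'] at hx
    simp at hx
  | succ n ih =>
    intro σ hσ I x hx
    cases σ with
    | nil => rw [spe_nil'] at hx; simp at hx
    | cons f rest =>
      have hr : rest.length ≤ n := by simpa using hσ
      rw [spe_cons'] at hx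
      split_ifs at hx with hw
      · rcases Finset.mem_insert.mp hx with h | h
        · simp [h]
        · have := ih _ ((contrO_length_le rest f).trans hr) _ x h
          exact List.mem_cons_of_mem _ (List.mem_of_mem_filter this)
      · exact List.mem_cons_of_mem _ (ih _ hr _ x hx)

theorem contrO_comm (σ : List (P × Q)) (e f : P × Q) :
    contrO (contrO σ e) f = contrO (contrO σ f) e := by
  unfold contrO
  exact List.filter_comm _ _ _

theorem spe_top (p : P) (q : Q) (n : ℕ) : ∀ (σ : List (P × Q)), σ.length ≤ n → ∀ (I : MI P Q),
    σ.Nodup → (p, q) ∈ σ →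
    σ.Pairwise (fun a b => ¬ (a.1 = p ∧ b = (p, q))) →
    (∀ p', (p', q) ∈ σ → p' ≠ p → I.rankQ q p < I.rankQ q p') →
    I.spe σ = insert (p, q) ((I.contr (p, q)).spe (contrO σ (p, q))) := by
  induction n with
  | zero =>
    intro σ hσ I _ hm
    have : σ = [] := List.length_eq_zero_iff.mp (by omega)
    subst this
    simp at hm
  | succ n ih =>
    intro σ hσ I hnd hm hpw htop
    cases σ with
    | nil => simp at hm
    | cons f rest =>
      have hr : rest.length ≤ n := by simpa using hσ
      have hnd' := List.nodup_cons.mp hnd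
      have hpw' := List.pairwise_cons.mp hpw
      by_cases hfe : f = (p, q)
      · subst hfe
        have hc : contrO ((p, q) :: rest) (p, q) = contrO rest (p, q) := by
          simp [contrO]
        rw [spe_cons', hc, if_pos]
        intro p' hp'
        have hp'' := spe_mem n rest hr _ _ hp'
        refine htop p' (List.mem_cons_of_mem _ hp'') ?_
        rintro rfl
        exact hnd'.1 hp''
      · have hm' : (p, q) ∈ rest := by
          rcases List.mem_cons.mp hm with h | h
          · exact absurd h.symm hfe
          · exact h
        have hf1 : f.1 ≠ p := fun h => hpw'.1 _ hm' ⟨h, rfl⟩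
        have hI := ih rest hr (I.del f) hnd'.2 hm' hpw'.2
          (fun p' hp' hne => htop p' (List.mem_cons_of_mem _ hp') hne)
        have hcd : ((I.del f).contr (p, q)).spe (contrO rest (p, q)) =
            (I.contr (p, q)).spe (contrO rest (p, q)) :=
          spe_congr _ _ le_rfl _ _ rfl
        by_cases hf2 : f.2 = q
        · have hc : contrO (f :: rest) (p, q) = contrO rest (p, q) := by
            simp [contrO, hf2]
          rw [spe_cons', hc, if_neg, hI, hcd]
          intro hw
          have h1 := hw p (by rw [hI, hf2]; exact Finset.mem_insert_self _ _)
          have h2 := htop f.1 (by rw [← hf2]; simp) hf1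
          rw [hf2] at h1
          omega
        · have hc : contrO (f :: rest) (p, q) = f :: contrO rest (p, q) := by
            simp [contrO, hf1, hf2]
          have hcd2 : ((I.contr (p, q)).del f).spe (contrO rest (p, q)) =
              (I.contr (p, q)).spe (contrO rest (p, q)) :=
            spe_congr _ _ le_rfl _ _ rfl
          have hmc : (p, q) ∈ contrO rest f := by
            simp [contrO, hm', Ne.symm hf1, Ne.symm hf2]
          have hJ := ih (contrO rest f) ((contrO_length_le rest f).trans hr) (I.contr f)
            (hnd'.2.filter _) hmc (hpw'.2.filter _)
            (fun p' hp' hne => htop p'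
              (List.mem_cons_of_mem _ (List.mem_of_mem_filter hp')) hne)
          have hcc : ((I.contr f).contr (p, q)).spe (contrO (contrO rest f) (p, q)) =
              ((I.contr (p, q)).contr f).spe (contrO (contrO rest (p, q)) f) := by
            rw [contrO_comm rest f (p, q)]
            exact spe_congr _ _ le_rfl _ _ rfl
          have hiff : I.WBelow ((I.del f).spe rest) f.2 f.1 ↔
              (I.contr (p, q)).WBelow
                (((I.contr (p, q)).del f).spe (contrO rest (p, q))) f.2 f.1 := by
            rw [hI, hcd, hcd2]
            unfold WBelow
            refine forall_congr' fun p' => ?_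
            simp [contr, hf2]
          rw [hc, spe_cons', spe_cons']
          by_cases hw : I.WBelow ((I.del f).spe rest) f.2 f.1
          · rw [if_pos hw, if_pos (hiff.mp hw), hJ, hcc, Finset.insert_comm]
          · rw [if_neg hw, if_neg (fun h => hw (hiff.mpr h)), hI, hcd, hcd2]

/-- for a top-top pair `e = (p, q)` (each most preferred by the other),
`spe(I, σ) = spe(I/e, σ/e) + e`; in particular `e` is matched in the SPE matching. -/
theorem stmt_16 (P Q : Type) [DecidableEq P] [DecidableEq Q] (I : MI P Q)
    (σ : List (P × Q)) (hσ : I.IsOfferOrder σ) (p : P) (q : Q)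
    (hfp : I.TopForFirm p q) (hwq : I.TopForWorker q p) :
    I.spe σ = insert (p, q) ((I.contr (p, q)).spe (contrO σ (p, q))) ∧
    (p, q) ∈ I.spe σ := by
  have key : I.spe σ = insert (p, q) ((I.contr (p, q)).spe (contrO σ (p, q))) := by
    obtain ⟨hnd, hmem, hord⟩ := hσ
    refine spe_top p q _ σ le_rfl I hnd ((hmem _).mpr hfp.1) ?_ ?_
    · rw [List.pairwise_iff_getElem]
      rintro i j hi hj hij ⟨h1, h2⟩
      have hne : σ[i] ≠ (p, q) := by
        intro h
        have := (hnd.getElem_inj_iff (hi := hi) (hj := hj)).mp (h.trans h2.symm)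
        omega
      have hiE : (p, σ[i].2) ∈ I.E := by
        rw [← h1]
        exact (hmem _).mp (List.getElem_mem hi)
      have hlt : I.rankP p q < I.rankP p σ[i].2 := by
        refine lt_of_le_of_ne (hfp.2 _ hiE) fun h => hne ?_
        have := I.injP p q _ hfp.1 hiE h
        exact Prod.ext h1 this.symm
      have h3 := hord σ[j] σ[i] (List.getElem_mem hj) (List.getElem_mem hi)
        (by rw [h2, h1]) (by rw [h2, h1]; exact hlt)
      rw [hnd.idxOf_getElem j hj, hnd.idxOf_getElem i hi] at h3
      omega
    · intro p' hp' hne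
      have hE := (hmem _).mp hp'
      exact lt_of_le_of_ne (hwq.2 _ hE) fun h => hne (I.injQ q p p' hwq.1 hE h).symm
  refine ⟨key, ?_⟩
  rw [key]
  exact Finset.mem_insert_self _ _

end MI

end SeqMatching
end

section
/- Let I be a matching instance such that for every pair (p,q) ∈ qopt(I) the worker q is the most preferred worker on p's list. Then there exists a position-based offering order σ on I such that spe(I,σ)=qopt(I). -/
namespace SeqMatching

namespace MI

variable {P Q : Type}

variable [DecidableEq P] [DecidableEq Q]

/-- `σ` is position-based: the offers of each firm appear contiguously in `σ`, i.e., `σ`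
is induced by some order on the firms. -/
def IsPositionBased (σ : List (P × Q)) : Prop :=
  ∀ e f g : P × Q, e ∈ σ → f ∈ σ → g ∈ σ → e.1 = g.1 →
    σ.idxOf e ≤ σ.idxOf f → σ.idxOf f ≤ σ.idxOf g → f.1 = e.1

/-- `r` is the best worker for `p` among those preferring `p` to their partner in `μ`. -/
def NextW (I : MI P Q) (μ : Finset (P × Q)) (p : P) (r : Q) : Prop :=
  (p, r) ∈ I.E ∧ I.WBelow μ r p ∧
    ∀ r', (p, r') ∈ I.E → I.WBelow μ r' p → I.rankP p r ≤ I.rankP p r'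

def NextF (I : MI P Q) (μ : Finset (P × Q)) (p p' : P) : Prop :=
  ∃ r, I.NextW μ p r ∧ (p', r) ∈ μ

theorem exists_nextW (I : MI P Q) (μ : Finset (P × Q)) (p : P) (q : Q)
    (h : (p, q) ∈ I.E) (hb : I.WBelow μ q p) : ∃ r, I.NextW μ p r := by
  classical
  obtain ⟨e, he, hmin⟩ := Finset.exists_min_image
    (I.E.filter (fun e => e.1 = p ∧ I.WBelow μ e.2 p)) (fun e => I.rankP p e.2)
    ⟨(p, q), by simp [h, hb]⟩
  obtain ⟨a, r⟩ := e
  simp only [Finset.mem_filter] at he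
  obtain ⟨h1, rfl, h3⟩ := he
  refine ⟨r, h1, h3, fun r' h4 h5 => ?_⟩
  exact hmin (a, r') (by simp [h4, h5])

theorem no_cycle (I : MI P Q) (μ : Finset (P × Q)) (h₀ : I.IsQOpt μ) (S : Finset P)
    (hS : S.Nonempty) : ∃ p ∈ S, ∀ p' ∈ S, ¬ I.NextF μ p p' := by
  induction S using Finset.strongInduction with
  | H S ih =>
  by_contra hcon
  push Not at hcon
  choose! f hfS hf using hcon
  have hQne : Nonempty Q := by
    obtain ⟨p, hp⟩ := hS
    obtain ⟨r, -⟩ := hf p hp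
    exact ⟨r⟩
  choose! s hs hsμ using hf
  have himg : S.image f = S := by
    by_contra hne
    have hsub : S.image f ⊆ S := by
      intro x hx
      obtain ⟨y, hy, rfl⟩ := Finset.mem_image.1 hx
      exact hfS y hy
    obtain ⟨p, hp, hp'⟩ := ih (S.image f) (Finset.ssubset_iff_subset_ne.2 ⟨hsub, hne⟩) (hS.image f)
    exact hp' (f p) (Finset.mem_image_of_mem f (hsub hp)) ⟨s p, hs p (hsub hp), hsμ p (hsub hp)⟩
  have hinj : ∀ x ∈ S, ∀ y ∈ S, f x = f y → x = y := by
    have : Set.InjOn f S := Finset.card_image_iff.1 (by rw [himg])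
    exact fun x hx y hy h => this hx hy h
  obtain ⟨⟨⟨hμE, hμm⟩, hμs⟩, hopt⟩ := h₀
  let μ' : Finset (P × Q) := μ.filter (fun e => e.1 ∉ S) ∪ S.image (fun p => (p, s p))
  have hmem : ∀ p q, (p, q) ∈ μ' ↔ ((p, q) ∈ μ ∧ p ∉ S) ∨ (p ∈ S ∧ q = s p) := by
    intro p q
    simp only [μ', Finset.mem_union, Finset.mem_filter, Finset.mem_image, Prod.mk.injEq]
    constructor
    · rintro (h | ⟨a, ha, rfl, rfl⟩)
      · exact Or.inl h
      · exact Or.inr ⟨ha, rfl⟩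
    · rintro (h | ⟨ha, rfl⟩)
      · exact Or.inl h
      · exact Or.inr ⟨p, ha, rfl, rfl⟩
  have hgain : ∀ p q, (p, q) ∈ μ → ∃ p'', (p'', q) ∈ μ' ∧ I.rankQ q p'' ≤ I.rankQ q p ∧
      (p ∈ S → I.rankQ q p'' < I.rankQ q p) := by
    intro p q h
    by_cases hp : p ∈ S
    · have : p ∈ S.image f := by rw [himg]; exact hp
      obtain ⟨a, ha, rfl⟩ := Finset.mem_image.1 this
      have hq : q = s a := by
        have := hμm _ h _ (hsμ a ha) (Or.inl rfl)
        simpa using this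
      subst hq
      have h2 := (hs a ha).2.1 _ (hsμ a ha)
      exact ⟨a, (hmem _ _).2 (Or.inr ⟨ha, rfl⟩), h2.le, fun _ => h2⟩
    · exact ⟨p, (hmem _ _).2 (Or.inl ⟨h, hp⟩), le_rfl, fun h => absurd h hp⟩
  have hstab : I.IsStable μ' := by
    refine ⟨⟨?_, ?_⟩, ?_⟩
    · rintro ⟨p, q⟩ h
      rw [hmem] at h
      rcases h with h | ⟨h, rfl⟩
      · exact hμE h.1
      · exact (hs p h).1
    · rintro ⟨p, q⟩ h ⟨p', q'⟩ h' hor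
      simp only at hor
      rw [hmem] at h h'
      rcases h with h | ⟨h, rfl⟩ <;> rcases h' with h' | ⟨h', rfl⟩
      · exact hμm _ h.1 _ h'.1 hor
      · rcases hor with rfl | rfl
        · exact absurd h' h.2
        · have := hμm _ h.1 _ (hsμ p' h') (Or.inr rfl)
          simp only [Prod.mk.injEq] at this
          exact absurd (this.1 ▸ hfS p' h') h.2
      · rcases hor with rfl | rfl
        · exact absurd h h'.2
        · have := hμm _ h'.1 _ (hsμ p h) (Or.inr rfl)
          simp only [Prod.mk.injEq] at this
          exact absurd (this.1 ▸ hfS p h) h'.2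
      · rcases hor with rfl | hor
        · rfl
        · have h1 := hsμ p h
          rw [hor] at h1
          have := hμm _ h1 _ (hsμ p' h') (Or.inr rfl)
          simp only [Prod.mk.injEq] at this
          have := hinj p h p' h' this.1
          subst this
          rfl
    · rintro ⟨p, q⟩ ⟨hE, hF, hW⟩
      simp only at hF hW
      have hW' : I.WBelow μ q p := by
        intro p' h
        obtain ⟨p'', h1, h2, -⟩ := hgain p' q h
        exact lt_of_lt_of_le (hW _ h1) h2
      by_cases hp : p ∈ S
      · have h1 := hF (s p) ((hmem _ _).2 (Or.inr ⟨hp, rfl⟩))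
        have h2 := (hs p hp).2.2 q hE hW'
        omega
      · refine hμs (p, q) ⟨hE, ?_, hW'⟩
        intro q' h
        exact hF q' ((hmem _ _).2 (Or.inl ⟨h, hp⟩))
  obtain ⟨p, hp⟩ := hS
  obtain ⟨p'', h1, h2⟩ := hopt μ' hstab (s p) p ((hmem _ _).2 (Or.inr ⟨hp, rfl⟩))
  have h3 := (hs p hp).2.1 _ h1
  rcases h2 with rfl | h2 <;> omega

theorem exists_pos {α : Type} [DecidableEq α] (R : α → α → Prop)
    (hR : ∀ S : Finset α, S.Nonempty → ∃ p ∈ S, ∀ p' ∈ S, ¬ R p p') (F : Finset α) :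
    ∃ pos : α → ℕ, (∀ x ∈ F, ∀ y ∈ F, pos x = pos y → x = y) ∧
      ∀ x ∈ F, ∀ y ∈ F, R x y → pos x < pos y := by
  induction F using Finset.strongInduction with
  | H F ih =>
  rcases F.eq_empty_or_nonempty with rfl | hF
  · exact ⟨fun _ => 0, by simp, by simp⟩
  obtain ⟨p, hp, hsink⟩ := hR F hF
  obtain ⟨pos, h1, h2⟩ := ih (F.erase p) (Finset.erase_ssubset hp)
  have hle : ∀ x ∈ F, pos x < F.sup pos + 1 := fun x hx =>
    Nat.lt_succ_of_le (Finset.le_sup (f := pos) hx)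
  refine ⟨fun x => if x = p then F.sup pos + 1 else pos x, ?_, ?_⟩
  · intro x hx y hy h
    have := hle x hx
    have := hle y hy
    by_cases hxp : x = p <;> by_cases hyp : y = p <;> simp only [hxp, hyp, if_true, if_false] at h ⊢
    · omega
    · omega
    · exact h1 x (by simp [hx, hxp]) y (by simp [hy, hyp]) h
  · intro x hx y hy h
    have := hle x hx
    by_cases hxp : x = p
    · subst hxp; exact absurd h (hsink y hy)
    · by_cases hyp : y = p
      · simp only [hxp, hyp, if_true, if_false]; omega
      · simp only [hxp, hyp, if_false]
        exact h2 x (by simp [hx, hxp]) y (by simp [hy, hyp]) h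

theorem exists_sorted {α β : Type} [DecidableEq α] [LinearOrder β] (k : α → β) (E : Finset α)
    (hk : ∀ x ∈ E, ∀ y ∈ E, k x = k y → x = y) :
    ∃ σ : List α, (∀ x, x ∈ σ ↔ x ∈ E) ∧ σ.Pairwise (fun a b => k a < k b) := by
  induction E using Finset.strongInduction with
  | H E ih =>
  rcases E.eq_empty_or_nonempty with rfl | hE
  · exact ⟨[], by simp, by simp⟩
  obtain ⟨e, he, hmin⟩ := Finset.exists_min_image E k hE
  obtain ⟨σ, h1, h2⟩ := ih (E.erase e) (Finset.erase_ssubset he)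
    (fun x hx y hy => hk x (Finset.mem_of_mem_erase hx) y (Finset.mem_of_mem_erase hy))
  refine ⟨e :: σ, ?_, ?_⟩
  · intro x
    rw [List.mem_cons, h1, Finset.mem_erase]
    by_cases hx : x = e
    · simp [hx, he]
    · simp [hx]
  · rw [List.pairwise_cons]
    refine ⟨fun x hx => ?_, h2⟩
    have hx' := Finset.mem_erase.1 ((h1 x).1 hx)
    exact lt_of_le_of_ne (hmin x hx'.2) (fun h => hx'.1 (hk e he x hx'.2 h).symm)

theorem idx_lt {α β : Type} [BEq α] [LawfulBEq α] [LinearOrder β] (k : α → β) (σ : List α)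
    (h : σ.Pairwise (fun a b => k a < k b)) (a b : α) (ha : a ∈ σ) (hb : b ∈ σ)
    (hab : k a < k b) : σ.idxOf a < σ.idxOf b := by
  have ha' := List.idxOf_lt_length_iff.2 ha
  have hb' := List.idxOf_lt_length_iff.2 hb
  by_contra hcon
  rcases Nat.lt_or_eq_of_le (Nat.le_of_not_lt hcon) with h1 | h1
  · have := List.pairwise_iff_getElem.1 h _ _ hb' ha' h1
    simp only [List.getElem_idxOf] at this
    exact lt_asymm this hab
  · have := (List.idxOf_inj hb).1 h1
    subst this
    exact lt_irrefl _ hab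

theorem mem_del (I : MI P Q) (e : P × Q) (rest : List (P × Q)) (hn : e ∉ rest)
    (hm : ∀ x, x ∈ e :: rest ↔ x ∈ I.E) : ∀ x, x ∈ rest ↔ x ∈ (I.del e).E := by
  intro x
  simp only [del, Finset.mem_erase, ← hm, List.mem_cons]
  constructor
  · intro h
    exact ⟨fun h' => hn (h' ▸ h), Or.inr h⟩
  · rintro ⟨h, h' | h'⟩
    · exact absurd h' h
    · exact h'

theorem mem_contr (I : MI P Q) (e : P × Q) (rest : List (P × Q))
    (hm : ∀ x, x ∈ e :: rest ↔ x ∈ I.E) : ∀ x, x ∈ contrO rest e ↔ x ∈ (I.contr e).E := by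
  intro x
  simp only [contr, contrO, List.mem_filter, decide_eq_true_eq, Finset.mem_filter, ← hm,
    List.mem_cons]
  constructor
  · rintro ⟨h, h'⟩; exact ⟨Or.inr h, h'⟩
  · rintro ⟨rfl | h, h'⟩
    · exact absurd rfl h'.1
    · exact ⟨h, h'⟩

theorem spe_matching (n : ℕ) : ∀ (I : MI P Q) (σ : List (P × Q)), σ.length = n →
    (∀ x, x ∈ σ ↔ x ∈ I.E) → σ.Nodup → I.IsMatching (I.spe σ) := by
  induction n using Nat.strong_induction_on with
  | _ n ih =>
  intro I σ hn hm hnd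
  cases σ with
  | nil => rw [spe]; exact ⟨by simp, by simp⟩
  | cons e rest =>
    have hl : rest.length < n := by simp at hn; omega
    have hnd' := List.nodup_cons.1 hnd
    have hl' : (contrO rest e).length < n := lt_of_le_of_lt (List.length_filter_le _ _) hl
    rw [spe]
    split
    · obtain ⟨h1, h2⟩ := ih _ hl' (I.contr e) (contrO rest e) rfl (mem_contr I e rest hm)
        (hnd'.2.filter _)
      have h3 : ∀ x ∈ (I.contr e).spe (contrO rest e), x ∈ I.E ∧ x.1 ≠ e.1 ∧ x.2 ≠ e.2 := by
        intro x hx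
        have := h1 hx
        simpa only [contr, Finset.mem_filter] using this
      refine ⟨?_, ?_⟩
      · intro x hx
        rcases Finset.mem_insert.1 hx with rfl | hx
        · exact (hm _).1 (by simp)
        · exact (h3 x hx).1
      · intro x hx y hy hxy
        rcases Finset.mem_insert.1 hx with rfl | hx <;> rcases Finset.mem_insert.1 hy with rfl | hy
        · rfl
        · have := h3 y hy; rcases hxy with h | h
          · exact absurd h.symm this.2.1
          · exact absurd h.symm this.2.2
        · have := h3 x hx; rcases hxy with h | h
          · exact absurd h this.2.1
          · exact absurd h this.2.2
        · exact h2 x hx y hy hxy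
    · obtain ⟨h1, h2⟩ := ih _ hl (I.del e) rest rfl (mem_del I e rest hnd'.1 hm) hnd'.2
      exact ⟨h1.trans (Finset.erase_subset _ _), h2⟩

/-- A worker who is the first choice of `p` is guaranteed at least `p`. -/
theorem spe_guarantee (p : P) (q : Q) (n : ℕ) : ∀ (I : MI P Q) (σ : List (P × Q)), σ.length = n →
    (∀ x, x ∈ σ ↔ x ∈ I.E) → σ.Nodup → σ.Pairwise (fun a b => b = (p, q) → a.1 ≠ p) →
    (p, q) ∈ σ → ∃ p', (p', q) ∈ I.spe σ ∧ I.rankQ q p' ≤ I.rankQ q p := by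
  induction n using Nat.strong_induction_on with
  | _ n ih =>
  intro I σ hn hm hnd hpw hmem
  cases σ with
  | nil => simp at hmem
  | cons e rest =>
    have hl : rest.length < n := by simp at hn; omega
    have hnd' := List.nodup_cons.1 hnd
    have hpw' := List.pairwise_cons.1 hpw
    have hl' : (contrO rest e).length < n := lt_of_le_of_lt (List.length_filter_le _ _) hl
    by_cases he : e = (p, q)
    · subst he
      rw [spe]
      split
      · exact ⟨p, by simp, le_rfl⟩
      · next h =>
        simp only [WBelow] at h
        push Not at h
        exact h
    · have hr : (p, q) ∈ rest := by
        rcases List.mem_cons.1 hmem with h | h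
        · exact absurd h.symm he
        · exact h
      have hep : e.1 ≠ p := hpw'.1 _ hr rfl
      have hdel := ih _ hl (I.del e) rest rfl (mem_del I e rest hnd'.1 hm) hnd'.2 hpw'.2 hr
      rw [spe]
      split
      · next h =>
        by_cases heq : e.2 = q
        · obtain ⟨p', h1, h2⟩ := hdel
          subst heq
          refine ⟨e.1, by simp, ?_⟩
          exact (h p' h1).le.trans h2
        · obtain ⟨p', h1, h2⟩ := ih _ hl' (I.contr e) (contrO rest e) rfl (mem_contr I e rest hm)
            (hnd'.2.filter _) (hpw'.2.filter _) (by
              simp only [contrO, List.mem_filter, decide_eq_true_eq]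
              exact ⟨hr, fun h => hep h.symm, fun h => heq h.symm⟩)
          exact ⟨p', Finset.mem_insert_of_mem h1, h2⟩
      · exact hdel

/-- A worker not yet matched who finally prefers `p` was not reached by `p`. -/
theorem spe_reject {β : Type} [LinearOrder β] (k : P × Q → β) (p : P) (r : Q) (n : ℕ) :
    ∀ (I : MI P Q) (σ : List (P × Q)), σ.length = n →
    σ.Pairwise (fun a b => k a < k b) → (p, r) ∈ σ → I.WBelow (I.spe σ) r p →
    (∀ p'', (p'', r) ∈ I.spe σ → k (p, r) < k (p'', r)) →
    ∃ r', (p, r') ∈ I.spe σ ∧ k (p, r') < k (p, r) := by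
  induction n using Nat.strong_induction_on with
  | _ n ih =>
  intro I σ hn hpw hmem hb hk
  cases σ with
  | nil => simp at hmem
  | cons e rest =>
    have hl : rest.length < n := by simp at hn; omega
    have hpw' := List.pairwise_cons.1 hpw
    have hl' : (contrO rest e).length < n := lt_of_le_of_lt (List.length_filter_le _ _) hl
    by_cases he : e = (p, r)
    · subst he
      rw [spe] at hb
      split at hb
      · exact absurd (hb p (by simp)) (lt_irrefl _)
      · next h => exact absurd hb h
    · have hr : (p, r) ∈ rest := by
        rcases List.mem_cons.1 hmem with h | h
        · exact absurd h.symm he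
        · exact h
      have hke := hpw'.1 _ hr
      rw [spe] at hb hk ⊢
      split
      · next h =>
        rw [if_pos h] at hb hk
        by_cases heq : e.2 = r
        · have := hk e.1 (by rw [← heq]; simp)
          rw [← heq] at this hke
          exact absurd this (lt_asymm hke)
        · by_cases hep : e.1 = p
          · refine ⟨e.2, by rw [← hep]; simp, ?_⟩
            rw [← hep] at hke ⊢
            exact hke
          · obtain ⟨r', h1, h2⟩ := ih _ hl' (I.contr e) (contrO rest e) rfl (hpw'.2.filter _) (by
              simp only [contrO, List.mem_filter, decide_eq_true_eq]
              exact ⟨hr, fun h => hep h.symm, fun h => heq h.symm⟩)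
              (fun x hx => hb x (Finset.mem_insert_of_mem hx))
              (fun x hx => hk x (Finset.mem_insert_of_mem hx))
            exact ⟨r', Finset.mem_insert_of_mem h1, h2⟩
      · next h =>
        rw [if_neg h] at hb hk
        exact ih _ hl (I.del e) rest rfl hpw'.2 hr hb hk

/-- The combinatorial core. -/
theorem core (I : MI P Q) (μ M : Finset (P × Q)) (hμ : I.IsStable μ) (hM : I.IsMatching M)
    (pos : P → ℕ)
    (hpos : ∀ p p', (∃ q, (p, q) ∈ I.E) → (∃ q, (p', q) ∈ I.E) → I.NextF μ p p' → pos p < pos p')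
    (hg : ∀ p q, (p, q) ∈ μ → ∃ p', (p', q) ∈ M ∧ I.rankQ q p' ≤ I.rankQ q p)
    (hrej : ∀ p r, (p, r) ∈ I.E → I.WBelow M r p → (∀ p'', (p'', r) ∈ M → pos p < pos p'') →
      ∃ r', (p, r') ∈ M ∧ I.rankP p r' < I.rankP p r) : M = μ := by
  obtain ⟨⟨hμE, hμm⟩, hμs⟩ := hμ
  obtain ⟨hME, hMm⟩ := hM
  have hWB : ∀ p q, (p, q) ∈ M → (p, q) ∉ μ → I.WBelow μ q p := by
    intro p q h h' p0 h0
    obtain ⟨p', h1, h2⟩ := hg p0 q h0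
    have := hMm _ h _ h1 (Or.inr rfl)
    simp only [Prod.mk.injEq, and_true] at this
    subst this
    refine lt_of_le_of_ne h2 (fun h3 => ?_)
    have := I.injQ q p p0 (hME h) (hμE h0) h3
    subst this
    exact h' h0
  have hfirm : ∀ p q, (p, q) ∈ M → ∃ q', (p, q') ∈ μ := by
    intro p q h
    by_cases h' : (p, q) ∈ μ
    · exact ⟨q, h'⟩
    by_contra hno
    push Not at hno
    exact hμs (p, q) ⟨hME h, fun q' hq' => absurd hq' (hno q'), hWB p q h h'⟩
  -- counting
  have hQ : μ.image Prod.snd ⊆ M.image Prod.snd := by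
    intro q hq
    obtain ⟨⟨p, q'⟩, h, rfl⟩ := Finset.mem_image.1 hq
    obtain ⟨p', h1, -⟩ := hg p q' h
    exact Finset.mem_image.2 ⟨(p', q'), h1, rfl⟩
  have hP : M.image Prod.fst ⊆ μ.image Prod.fst := by
    intro p hp
    obtain ⟨⟨p', q⟩, h, rfl⟩ := Finset.mem_image.1 hp
    obtain ⟨q', h1⟩ := hfirm p' q h
    exact Finset.mem_image.2 ⟨(p', q'), h1, rfl⟩
  have c1 : (μ.image Prod.snd).card = μ.card :=
    Finset.card_image_of_injOn (fun x hx y hy h => hμm x hx y hy (Or.inr h))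
  have c2 : (M.image Prod.snd).card = M.card :=
    Finset.card_image_of_injOn (fun x hx y hy h => hMm x hx y hy (Or.inr h))
  have c3 : (μ.image Prod.fst).card = μ.card :=
    Finset.card_image_of_injOn (fun x hx y hy h => hμm x hx y hy (Or.inl h))
  have c4 : (M.image Prod.fst).card = M.card :=
    Finset.card_image_of_injOn (fun x hx y hy h => hMm x hx y hy (Or.inl h))
  have d1 := Finset.card_le_card hQ
  have d2 := Finset.card_le_card hP
  have hQe := Finset.eq_of_subset_of_card_le hQ (by omega)
  have hPe := Finset.eq_of_subset_of_card_le hP (by omega)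
  have hworker : ∀ p q, (p, q) ∈ M → ∃ p', (p', q) ∈ μ := by
    intro p q h
    have : q ∈ μ.image Prod.snd := by rw [hQe]; exact Finset.mem_image.2 ⟨(p, q), h, rfl⟩
    obtain ⟨⟨p', q'⟩, h2, rfl⟩ := Finset.mem_image.1 this
    exact ⟨p', h2⟩
  have hfirm' : ∀ p q, (p, q) ∈ μ → ∃ q', (p, q') ∈ M := by
    intro p q h
    have : p ∈ M.image Prod.fst := by rw [hPe]; exact Finset.mem_image.2 ⟨(p, q), h, rfl⟩
    obtain ⟨⟨p', q'⟩, h2, rfl⟩ := Finset.mem_image.1 this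
    exact ⟨q', h2⟩
  have hsub : M ⊆ μ := by
    by_contra hns
    have hne : (M \ μ).Nonempty := Finset.sdiff_nonempty.2 hns
    obtain ⟨⟨p, q⟩, he, hmax⟩ := Finset.exists_max_image (M \ μ) (fun e => pos e.1) hne
    obtain ⟨heM, heμ⟩ := Finset.mem_sdiff.1 he
    simp only at hmax
    have hb := hWB p q heM heμ
    obtain ⟨r, hr⟩ := I.exists_nextW μ p q (hME heM) hb
    have hle := hr.2.2 q (hME heM) hb
    -- any μ-partner of r keeps r in M
    have key : ∀ pm, (pm, r) ∈ μ → (pm, r) ∈ M ∧ pos p < pos pm := by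
      intro pm hpm
      have hlt := hpos p pm ⟨q, hME heM⟩ ⟨r, hμE hpm⟩ ⟨r, hr, hpm⟩
      obtain ⟨r', hr'⟩ := hfirm' pm r hpm
      by_cases hin : (pm, r') ∈ μ
      · have := hμm _ hpm _ hin (Or.inl rfl)
        rw [this]
        exact ⟨hr', hlt⟩
      · have := hmax (pm, r') (Finset.mem_sdiff.2 ⟨hr', hin⟩)
        simp only at this
        omega
    have key2 : ∀ p'', (p'', r) ∈ M → (p'', r) ∈ μ := by
      intro p'' h
      obtain ⟨pm, hpm⟩ := hworker p'' r h
      have := hMm _ h _ (key pm hpm).1 (Or.inr rfl)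
      rw [this]
      exact hpm
    obtain ⟨r', h1, h2⟩ := hrej p r hr.1 (fun p'' h => hr.2.1 p'' (key2 p'' h))
      (fun p'' h => (key p'' (key2 p'' h)).2)
    have := hMm _ h1 _ heM (Or.inl rfl)
    simp only [Prod.mk.injEq, true_and] at this
    subst this
    omega
  exact Finset.eq_of_subset_of_card_le hsub (by omega)

/-- if for every pair `(p, q) ∈ qopt(I)` the worker `q` is the most preferred
on `p`'s list, then there is a position-based offering order `σ` with `spe(I, σ) = qopt(I)`. -/
theorem stmt_18 (P Q : Type) [DecidableEq P] [DecidableEq Q] (I : MI P Q)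
    (μ₀ : Finset (P × Q)) (h₀ : I.IsQOpt μ₀)
    (htop : ∀ e ∈ μ₀, I.TopForFirm e.1 e.2) :
    ∃ σ : List (P × Q), I.IsOfferOrder σ ∧ IsPositionBased σ ∧ I.spe σ = μ₀ := by
  classical
  obtain ⟨pos, hinj, hpos⟩ := exists_pos (I.NextF μ₀) (fun S hS => I.no_cycle μ₀ h₀ S hS)
    (I.E.image Prod.fst)
  have hF : ∀ e ∈ I.E, e.1 ∈ I.E.image Prod.fst := fun e he => Finset.mem_image_of_mem _ he
  let k : P × Q → ℕ ×ₗ ℕ := fun e => toLex (pos e.1, I.rankP e.1 e.2)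
  have hklt : ∀ a b, k a < k b ↔ pos a.1 < pos b.1 ∨
      (pos a.1 = pos b.1 ∧ I.rankP a.1 a.2 < I.rankP b.1 b.2) := by
    intro a b
    simp only [k, Prod.Lex.toLex_lt_toLex]
  have hk : ∀ x ∈ I.E, ∀ y ∈ I.E, k x = k y → x = y := by
    rintro ⟨p, q⟩ hx ⟨p', q'⟩ hy h
    simp only [k, EmbeddingLike.apply_eq_iff_eq, Prod.mk.injEq] at h
    have := hinj p (hF _ hx) p' (hF _ hy) h.1
    subst this
    rw [I.injP p q q' hx hy h.2]
  obtain ⟨σ, hmem, hpw⟩ := exists_sorted k I.E hk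
  have hnd : σ.Nodup := hpw.imp (fun {a b} h hab => by subst hab; exact lt_irrefl _ h)
  have hidx := idx_lt k σ hpw
  have hidx' : ∀ a b, a ∈ σ → b ∈ σ → σ.idxOf a ≤ σ.idxOf b → k a ≤ k b := by
    intro a b ha hb h
    by_contra hc
    have := hidx b a hb ha (not_le.1 hc)
    omega
  have hpm : ∀ a b, k a ≤ k b → pos a.1 ≤ pos b.1 := by
    intro a b h
    by_contra hc
    exact absurd ((hklt b a).2 (Or.inl (not_le.1 hc))) (not_lt.2 h)
  refine ⟨σ, ⟨hnd, hmem, ?_⟩, ?_, ?_⟩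
  · intro e f he hf h1 h2
    exact hidx e f he hf ((hklt e f).2 (Or.inr ⟨by rw [h1], h2⟩))
  · intro e f g he hf hg' heg h1 h2
    have h3 := hpm _ _ (hidx' e f he hf h1)
    have h4 := hpm _ _ (hidx' f g hf hg' h2)
    rw [← heg] at h4
    exact hinj _ (hF _ ((hmem _).1 hf)) _ (hF _ ((hmem _).1 he)) (le_antisymm h4 h3)
  · refine I.core μ₀ (I.spe σ) h₀.1 (spe_matching _ I σ rfl hmem hnd) pos ?_ ?_ ?_
    · rintro p p' ⟨q, hq⟩ ⟨q', hq'⟩ h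
      exact hpos p (hF _ hq) p' (hF _ hq') h
    · intro p q h
      obtain ⟨ht1, ht2⟩ := htop _ h
      refine spe_guarantee p q _ I σ rfl hmem hnd ?_ ((hmem _).2 ht1)
      refine hpw.imp_of_mem ?_
      rintro ⟨a, b⟩ c ha hc hlt rfl hap
      simp only at hap
      subst hap
      have := ht2 b ((hmem _).1 ha)
      rw [hklt] at hlt
      simp only at hlt this
      omega
    · intro p r hE hb hlater
      obtain ⟨r', h1, h2⟩ := spe_reject k p r _ I σ rfl hpw ((hmem _).2 hE) hb
        (fun p'' h => (hklt _ _).2 (Or.inl (hlater p'' h)))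
      refine ⟨r', h1, ?_⟩
      rw [hklt] at h2
      simp only at h2
      omega

end MI

end SeqMatching
end

section
/- There exist a matching instance I and two offering orders σ₁, σ₂ on I such that the set of workers matched in spe(I,σ₁) differs from the set of workers matched in spe(I,σ₂); in particular, the set of matched firms and workers in the SPE matching can change according to the offering order. -/
namespace SeqMatching

namespace MI

variable {P Q : Type}

variable [DecidableEq P] [DecidableEq Q]

/-- computable list version of `spe`, by recursion on a length bound. -/
def cspe (rk : Q → P → ℕ) : ℕ → List (P × Q) → List (P × Q)
  | 0, _ => []
  | _ + 1, [] => []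
  | n + 1, e :: rest =>
    if ∀ f ∈ cspe rk n rest, f.2 = e.2 → rk e.2 e.1 < rk e.2 f.1
    then e :: cspe rk n (contrO rest e)
    else cspe rk n rest

theorem spe_eq_cspe (n : ℕ) : ∀ (I : MI P Q) (σ : List (P × Q)), σ.length ≤ n →
    I.spe σ = (cspe I.rankQ n σ).toFinset := by
  induction n with
  | zero =>
    intro I σ h
    have : σ = [] := List.length_eq_zero_iff.mp (Nat.le_zero.mp h)
    subst this
    rw [spe]
    simp [cspe]
  | succ n ih =>
    intro I σ h
    cases σ with
    | nil =>
      rw [spe]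
      simp [cspe]
    | cons e rest =>
      have hl : rest.length ≤ n := by simpa using h
      have hc : (contrO rest e).length ≤ n := (List.length_filter_le _ _).trans hl
      rw [spe, ih (I.del e) rest hl, ih (I.contr e) _ hc, cspe]
      have hiff : I.WBelow (cspe (I.del e).rankQ n rest).toFinset e.2 e.1 ↔
          ∀ f ∈ cspe I.rankQ n rest, f.2 = e.2 → I.rankQ e.2 e.1 < I.rankQ e.2 f.1 := by
        constructor
        · intro hw f hf hfe
          apply hw f.1
          rw [← hfe]
          exact List.mem_toFinset.mpr hf
        · intro hw p' hp'
          exact hw (p', e.2) (List.mem_toFinset.mp hp') rfl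
      by_cases hw : I.WBelow (cspe (I.del e).rankQ n rest).toFinset e.2 e.1
      · rw [if_pos hw, if_pos (hiff.mp hw), List.toFinset_cons]
        rfl
      · rw [if_neg hw, if_neg (fun h' => hw (hiff.mpr h'))]
        rfl

/-- first offering order of the example. -/
def exO1 : List (Fin 4 × Fin 4) :=
  [(3, 1), (2, 0), (1, 3), (3, 3), (2, 1), (0, 0), (1, 2), (3, 0)]

/-- second offering order of the example. -/
def exO2 : List (Fin 4 × Fin 4) :=
  [(0, 0), (1, 3), (3, 1), (2, 0), (3, 3), (1, 2), (3, 0), (2, 1)]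

/-- the example instance. -/
def exI : MI (Fin 4) (Fin 4) where
  E := exO1.toFinset
  rankP := ![![0, 9, 9, 9], ![9, 9, 1, 0], ![0, 1, 9, 9], ![2, 0, 9, 1]]
  rankQ := ![![1, 9, 2, 0], ![9, 9, 0, 1], ![9, 0, 9, 9], ![9, 1, 9, 0]]
  injP := by decide
  injQ := by decide

theorem exO1_offer : exI.IsOfferOrder exO1 := by
  refine ⟨by decide, by decide, by decide⟩

theorem exO2_offer : exI.IsOfferOrder exO2 := by
  refine ⟨by decide, by decide, by decide⟩

/-- there are a matching instance and two offering orders whose SPE matchings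
match different sets of workers (no rural-hospital-type invariance for SPE matchings). -/
theorem stmt_19 :
    ∃ (P Q : Type) (iP : DecidableEq P) (iQ : DecidableEq Q) (I : MI P Q)
      (σ₁ σ₂ : List (P × Q)),
      @MI.IsOfferOrder P Q iP iQ I σ₁ ∧ @MI.IsOfferOrder P Q iP iQ I σ₂ ∧
      ∃ q : Q, ¬ ((∃ p, (p, q) ∈ @MI.spe P Q iP iQ I σ₁) ↔
                   ∃ p, (p, q) ∈ @MI.spe P Q iP iQ I σ₂) := by
  refine ⟨Fin 4, Fin 4, inferInstance, inferInstance, exI, exO1, exO2, exO1_offer, exO2_offer,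
    2, ?_⟩
  rw [spe_eq_cspe 8 exI exO1 (by decide), spe_eq_cspe 8 exI exO2 (by decide)]
  simp only [List.mem_toFinset]
  decide

end MI

end SeqMatching
end
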